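/- arXiv:1604.01612 — 11 statements merged into one kernel-verified Lean document; each statement's English description precedes it below -/
import Mathlib

section
/- Let k ≥ 1 and l ≥ 1 be integers, let α₁ > α₂ > … > α_k be integers, and let β₁ > β₂ > … > β_l > 0 be integers. For t ∈ ℤ let v(t) ∈ ℤ^{k+l} be the vector with v(t)_i = α_i − t for 1 ≤ i ≤ k and v(t)_{k+j} = β_j for 1 ≤ j ≤ l. Then the following are equivalent: (a) some coordinate of v(t) equals 0, or v(t) has two coordinates with distinct indices that are equal, or v(t) has two coordinates with distinct indices whose sum is 0; (b) t belongs to {α_i + β_j : 1 ≤ i ≤ k, 1 ≤ j ≤ l} ∪ {α_i − β_j : 1 ≤ i ≤ k, 1 ≤ j ≤ l} ∪ {(α_i + α_j)/2 : 1 ≤ i ≤ j ≤ k and α_i + α_j is even}. -/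
/-- The vector `v(t) ∈ ℤ^{k+l}`: the first `k` coordinates are `αᵢ - t`
(0-based indices `0, …, k-1`), the remaining `l` coordinates are `βⱼ`. -/
def vvec (k : ℕ) (α β : ℕ → ℤ) (t : ℤ) (i : ℕ) : ℤ :=
  if i < k then α i - t else β (i - k)

theorem vvec_of_lt {k i : ℕ} (α β : ℕ → ℤ) (t : ℤ) (h : i < k) :
    vvec k α β t i = α i - t :=
  if_pos h

theorem vvec_add (k : ℕ) (α β : ℕ → ℤ) (t : ℤ) (j : ℕ) : vvec k α β t (k + j) = β j := by
  simp [vvec]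

theorem lt_or_exists_eq_add {k l i : ℕ} (h : i < k + l) : i < k ∨ ∃ j < l, i = k + j := by
  rcases lt_or_ge i k with hi | hi
  · exact Or.inl hi
  · exact Or.inr ⟨i - k, by omega, by omega⟩

theorem ne_of_strictly_decreasing {n : ℕ} {f : ℕ → ℤ}
    (hf : ∀ i j, i < j → j < n → f j < f i) {i j : ℕ} (hi : i < n) (hj : j < n)
    (hij : i ≠ j) : f i ≠ f j := by
  rcases hij.lt_or_gt with h | h
  · exact (hf i j h hj).ne'
  · exact (hf j i h hi).ne

/-- Singularity criterion in type `Cₙ`: for strictly decreasing integers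
`α₁ > … > α_k` and `β₁ > … > β_l > 0`, the vector `v(t)` has a zero
coordinate, two equal coordinates, or two coordinates summing to zero, if
and only if `t = αᵢ + βⱼ`, or `t = αᵢ - βⱼ`, or `t = (αᵢ + αⱼ)/2` for some
`i ≤ j` with `αᵢ + αⱼ` even. (Indices are 0-based.) -/
theorem stmt0 (k l : ℕ) (hk : 1 ≤ k) (hl : 1 ≤ l) (α β : ℕ → ℤ)
    (hα : ∀ i j, i < j → j < k → α j < α i)
    (hβ : ∀ i j, i < j → j < l → β j < β i)
    (hβpos : ∀ j < l, 0 < β j) (t : ℤ) :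
    ((∃ i < k + l, vvec k α β t i = 0) ∨
     (∃ i < k + l, ∃ j < k + l, i ≠ j ∧ vvec k α β t i = vvec k α β t j) ∨
     (∃ i < k + l, ∃ j < k + l, i ≠ j ∧ vvec k α β t i + vvec k α β t j = 0)) ↔
    ((∃ i < k, ∃ j < l, t = α i + β j) ∨
     (∃ i < k, ∃ j < l, t = α i - β j) ∨
     (∃ i j, i ≤ j ∧ j < k ∧ 2 * t = α i + α j)) := by
  constructor
  · rintro (⟨i, hi, h⟩ | ⟨i, hi, j, hj, hij, h⟩ | ⟨i, hi, j, hj, hij, h⟩)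
    · rcases lt_or_exists_eq_add hi with hi | ⟨a, ha, rfl⟩
      · rw [vvec_of_lt α β t hi] at h
        exact Or.inr (Or.inr ⟨i, i, le_rfl, hi, by omega⟩)
      · rw [vvec_add] at h
        exact absurd h (hβpos a ha).ne'
    · rcases lt_or_exists_eq_add hi with hi | ⟨a, ha, rfl⟩ <;>
        rcases lt_or_exists_eq_add hj with hj | ⟨b, hb, rfl⟩
      · rw [vvec_of_lt α β t hi, vvec_of_lt α β t hj] at h
        exact absurd (sub_left_inj.mp h) (ne_of_strictly_decreasing hα hi hj hij)
      · rw [vvec_of_lt α β t hi, vvec_add] at h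
        exact Or.inr (Or.inl ⟨i, hi, b, hb, by omega⟩)
      · rw [vvec_of_lt α β t hj, vvec_add] at h
        exact Or.inr (Or.inl ⟨j, hj, a, ha, by omega⟩)
      · rw [vvec_add, vvec_add] at h
        exact absurd h (ne_of_strictly_decreasing hβ ha hb (by omega))
    · rcases lt_or_exists_eq_add hi with hi | ⟨a, ha, rfl⟩ <;>
        rcases lt_or_exists_eq_add hj with hj | ⟨b, hb, rfl⟩
      · rw [vvec_of_lt α β t hi, vvec_of_lt α β t hj] at h
        rcases le_total i j with hle | hle
        · exact Or.inr (Or.inr ⟨i, j, hle, hj, by omega⟩)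
        · exact Or.inr (Or.inr ⟨j, i, hle, hi, by omega⟩)
      · rw [vvec_of_lt α β t hi, vvec_add] at h
        exact Or.inl ⟨i, hi, b, hb, by omega⟩
      · rw [vvec_of_lt α β t hj, vvec_add] at h
        exact Or.inl ⟨j, hj, a, ha, by omega⟩
      · rw [vvec_add, vvec_add] at h
        exact absurd h (add_pos (hβpos a ha) (hβpos b hb)).ne'
  · rintro (⟨i, hi, j, hj, h⟩ | ⟨i, hi, j, hj, h⟩ | ⟨i, j, hij, hj, h⟩)
    · refine Or.inr (Or.inr ⟨i, by omega, k + j, by omega, by omega, ?_⟩)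
      rw [vvec_of_lt α β t hi, vvec_add]
      omega
    · refine Or.inr (Or.inl ⟨i, by omega, k + j, by omega, by omega, ?_⟩)
      rw [vvec_of_lt α β t hi, vvec_add]
      omega
    · rcases hij.eq_or_lt with rfl | hlt
      · refine Or.inl ⟨i, by omega, ?_⟩
        rw [vvec_of_lt α β t hj]
        omega
      · refine Or.inr (Or.inr ⟨i, by omega, j, by omega, hlt.ne, ?_⟩)
        rw [vvec_of_lt α β t (hlt.trans hj), vvec_of_lt α β t hj]
        omega
end

section
/- With the notation of the context, assume k ≥ 2. If S_C(α,β) = {1, 2, …, d}, then d is odd. -/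
/-- The set `S_C(α,β) = {αᵢ + βⱼ} ∪ {αᵢ - βⱼ} ∪ {(αᵢ + αⱼ)/2 : i ≤ j, αᵢ + αⱼ even}`,
with 0-based indices `i < k`, `j < l`. -/
def SC (k l : ℕ) (α β : ℕ → ℤ) : Set ℤ :=
  {t | (∃ i < k, ∃ j < l, t = α i + β j) ∨
       (∃ i < k, ∃ j < l, t = α i - β j) ∨
       (∃ i j, i ≤ j ∧ j < k ∧ 2 * t = α i + α j)}

/-- If `α 0 + α (k - 1)` is odd, the pair `(0, k - 1)` contributes no midpoint, so `SC` is covered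
by a finite set with fewer than `2kl + k(k+1)/2` elements. -/
lemma SC_subset_finset_of_odd (k l : ℕ) (hk : 1 ≤ k) (α β : ℕ → ℤ)
    (hodd : Odd (α 0 + α (k - 1))) :
    ∃ T : Finset ℤ, SC k l α β ⊆ T ∧ T.card < 2 * k * l + k * (k + 1) / 2 := by
  let P : Finset (Σ _ : ℕ, ℕ) := (Finset.range k).sigma fun j => Finset.range (j + 1)
  have hmem : (⟨k - 1, 0⟩ : Σ _ : ℕ, ℕ) ∈ P := by
    simp only [P, Finset.mem_sigma, Finset.mem_range]
    omega
  have hP : P.card = k * (k + 1) / 2 := by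
    have h := Finset.sum_range_id (k + 1)
    rw [Finset.sum_range_succ'] at h
    simp only [P, Finset.card_sigma, Finset.card_range]
    rw [add_zero, Nat.add_sub_cancel, mul_comm] at h
    exact h
  refine ⟨((Finset.range k ×ˢ Finset.range l).image (fun p => α p.1 + β p.2) ∪
    (Finset.range k ×ˢ Finset.range l).image (fun p => α p.1 - β p.2)) ∪
    (P.erase ⟨k - 1, 0⟩).image (fun p => (α p.2 + α p.1) / 2), ?_, ?_⟩
  · rintro t (⟨i, hi, j, hj, rfl⟩ | ⟨i, hi, j, hj, rfl⟩ | ⟨i, j, hij, hj, ht⟩)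
    · refine Finset.mem_union_left _ (Finset.mem_union_left _ ?_)
      exact Finset.mem_image.2 ⟨(i, j), by simp [hi, hj], rfl⟩
    · refine Finset.mem_union_left _ (Finset.mem_union_right _ ?_)
      exact Finset.mem_image.2 ⟨(i, j), by simp [hi, hj], rfl⟩
    · refine Finset.mem_union_right _ (Finset.mem_image.2 ⟨⟨j, i⟩, ?_, ?_⟩)
      · refine Finset.mem_erase.2 ⟨fun he => ?_, ?_⟩
        · obtain ⟨rfl, hi⟩ := Sigma.mk.inj he
          obtain rfl := eq_of_heq hi
          obtain ⟨c, hc⟩ := hodd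
          omega
        · simp only [P, Finset.mem_sigma, Finset.mem_range]
          omega
      · simp only
        omega
  · have hprod : (Finset.range k ×ˢ Finset.range l).card = k * l := by simp
    have h₁ := Finset.card_image_le (s := Finset.range k ×ˢ Finset.range l)
      (f := fun p => α p.1 + β p.2)
    have h₂ := Finset.card_image_le (s := Finset.range k ×ˢ Finset.range l)
      (f := fun p => α p.1 - β p.2)
    have h₃ := Finset.card_image_le (s := P.erase ⟨k - 1, 0⟩)
      (f := fun p => (α p.2 + α p.1) / 2)
    have h₄ := Finset.card_erase_lt_of_mem hmem
    refine (Finset.card_union_le _ _).trans_lt ?_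
    refine (Nat.add_le_add_right (Finset.card_union_le _ _) _).trans_lt ?_
    rw [hprod] at h₁ h₂
    rw [hP] at h₄
    rw [mul_assoc]
    omega

/-- If `k ≥ 2` and `S_C(α,β) = {1, …, d}` with `d = 2kl + k(k+1)/2`,
then `d` is odd. -/
theorem stmt2 (k l : ℕ) (hk : 2 ≤ k) (hl : 1 ≤ l) (α β : ℕ → ℤ)
    (hα : ∀ i j, i < j → j < k → α j < α i)
    (hβ : ∀ i j, i < j → j < l → β j < β i)
    (hβpos : ∀ j < l, 0 < β j)
    (h : SC k l α β = Set.Icc (1 : ℤ) ((2 * k * l + k * (k + 1) / 2 : ℕ) : ℤ)) :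
    Odd (2 * k * l + k * (k + 1) / 2) := by
  have hα_le : ∀ i < k, α i ≤ α 0 ∧ α (k - 1) ≤ α i := fun i hi => by
    constructor
    · rcases Nat.eq_zero_or_pos i with rfl | h0
      · rfl
      · exact (hα 0 i h0 hi).le
    · rcases Nat.lt_or_ge i (k - 1) with h1 | h1
      · exact (hα i (k - 1) h1 (by omega)).le
      · rw [show i = k - 1 by omega]
  have hβ_le : ∀ j < l, β j ≤ β 0 := fun j hj => by
    rcases Nat.eq_zero_or_pos j with rfl | h0
    · rfl
    · exact (hβ 0 j h0 hj).le
  have hβ0 := hβpos 0 hl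
  have hbounds : ∀ t ∈ SC k l α β, α (k - 1) - β 0 ≤ t ∧ t ≤ α 0 + β 0 := by
    rintro t (⟨i, hi, j, hj, rfl⟩ | ⟨i, hi, j, hj, rfl⟩ | ⟨i, j, hij, hj, ht⟩)
    · have := hα_le i hi
      have := hβ_le j hj
      have := hβpos j hj
      omega
    · have := hα_le i hi
      have := hβ_le j hj
      have := hβpos j hj
      omega
    · have := hα_le i (by omega)
      have := hα_le j hj
      omega
  have hmax : α 0 + β 0 ∈ SC k l α β := Or.inl ⟨0, by omega, 0, hl, rfl⟩
  have hmin : α (k - 1) - β 0 ∈ SC k l α β := Or.inr (Or.inl ⟨k - 1, by omega, 0, hl, rfl⟩)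
  rw [h] at hmax hmin hbounds
  generalize hd : 2 * k * l + k * (k + 1) / 2 = d at *
  rw [Set.mem_Icc] at hmax hmin
  have hone := hbounds 1 (Set.mem_Icc.2 (by omega))
  have htop := hbounds d (Set.mem_Icc.2 (by omega))
  by_contra hnot
  obtain ⟨c, hc⟩ := Nat.not_odd_iff_even.1 hnot
  obtain ⟨T, hT, hcard⟩ := SC_subset_finset_of_odd k l (by omega) α β ⟨c, by omega⟩
  rw [h, ← Finset.coe_Icc, Finset.coe_subset] at hT
  have := Finset.card_le_card hT
  rw [Int.card_Icc] at this
  omega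
end

section
/- With the notation of the context, assume k ≥ 3 (and l ≥ 1). Then S_C(α,β) ≠ {1, 2, …, d}. Equivalently, there are no irreducible equivariant Ulrich bundles on the symplectic isotropic Grassmannian IGr(k, 2n) for 2 < k < n. -/
/-- Combinatorial core, in coordinates measured downwards from the top element `d`: a set `B`
symmetric about `b` and a Sidon sequence `a` of even numbers with at least three terms cannot
cover the initial segment `[0, 2b + a 2]` by the sums `a i + x`, `x ∈ B`, and the
midpoints `b + (a i + a j) / 2` without overlaps. -/
theorem false_of_sums_and_midpoints_tile (k : ℕ) (hk : 3 ≤ k) (a : ℕ → ℤ) (B : ℤ → Prop) (b : ℤ)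
    (hb : 1 ≤ b) (ha0 : a 0 = 0) (hmono : ∀ i j, i < j → j < k → a i < a j)
    (heven : ∀ i < k, 2 ∣ a i)
    (hB0 : B 0) (hBsymm : ∀ x, B x → B (2 * b - x)) (hBnonneg : ∀ x, B x → 0 ≤ x)
    (hcover : ∀ p, 0 ≤ p → p ≤ 2 * b + a 2 → (∃ i < k, ∃ x, B x ∧ p = a i + x) ∨
      (∃ i < k, ∃ j < k, 2 * p = 2 * b + a i + a j))
    (hsum : ∀ i < k, ∀ j < k, ∀ x y, B x → B y → a i + x = a j + y → i = j)
    (hmid : ∀ i < k, ∀ j < k, ∀ m < k, ∀ x, B x → 2 * (a i + x) ≠ 2 * b + a j + a m)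
    (hsidon : ∀ i j m n, i ≤ j → j < k → m ≤ n → n < k → a i + a j = a m + a n →
      i = m ∧ j = n) : False := by
  have h01 := hmono 0 1 (by omega) (by omega)
  have h12 := hmono 1 2 (by omega) (by omega)
  have he1 := heven 1 (by omega)
  have he2 := heven 2 (by omega)
  have index : ∀ i < k, i = 0 ∨ i = 1 ∨ i = 2 ∨ (3 ≤ i ∧ a 2 < a i) := by
    intro i hi
    rcases Nat.lt_or_ge i 3 with h | h
    · omega
    · exact Or.inr (Or.inr (Or.inr ⟨h, hmono 2 i (by omega) hi⟩))
  have anonneg : ∀ i < k, 0 ≤ a i := by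
    intro i hi
    rcases index i hi with rfl | rfl | rfl | ⟨_, h⟩ <;> omega
  have sidon_mid : a 2 ≠ 2 * a 1 := by
    intro h
    have := hsidon 0 2 1 1 (by omega) (by omega) (by omega) (by omega) (by omega)
    omega
  have sidon_add : ∀ i < k, a i ≠ a 1 + a 2 := by
    intro i hi h
    have := hsidon 0 i 1 2 (by omega) (by omega) (by omega) (by omega) (by omega)
    omega
  have low : ∀ p, 0 ≤ p → p < b → ∃ i < k, ∃ x, B x ∧ p = a i + x := by
    intro p hp hpb
    rcases hcover p hp (by omega) with h | ⟨i, hi, j, hj, h⟩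
    · exact h
    · have := anonneg i hi
      have := anonneg j hj
      omega
  have block : ∀ p, 0 ≤ p → p < b → p < a 1 → B p := by
    intro p hp hpb hpd
    obtain ⟨i, hi, x, hx, h⟩ := low p hp hpb
    have := hBnonneg x hx
    rcases index i hi with rfl | rfl | rfl | ⟨_, _⟩
    · rwa [h, ha0, zero_add]
    all_goals omega
  have not_B : ∀ i < k, 0 < i → ¬ B (a i) := by
    intro i hi hpos h
    have := hsum 0 (by omega) i hi (a i) 0 h hB0 (by omega)
    omega
  -- The case `a 2 < b`.
  have hba : b ≤ a 2 := by
    by_contra! hlt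
    have hlt2 : 2 * a 1 < a 2 := by
      by_contra! hle
      have hB := block (a 2 - a 1) (by omega) (by omega) (by omega)
      have := hsum 1 (by omega) 2 (by omega) _ 0 hB hB0 (by omega)
      omega
    have hB2 : B (2 * a 1) := by
      obtain ⟨i, hi, x, hx, h⟩ := low (2 * a 1) (by omega) (by omega)
      have := hBnonneg x hx
      rcases index i hi with rfl | rfl | rfl | ⟨_, _⟩
      · rwa [h, ha0, zero_add]
      · obtain rfl : x = a 1 := by omega
        exact absurd hx (not_B 1 (by omega) (by omega))
      all_goals omega
    rcases lt_trichotomy (a 2 + a 1) b with hq | hq | hq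
    · obtain ⟨i, hi, x, hx, h⟩ := low (a 2 + a 1) (by omega) hq
      have := hBnonneg x hx
      rcases index i hi with rfl | rfl | rfl | ⟨h3, _⟩
      · have := hsum 1 (by omega) 2 (by omega) x (2 * a 1) hx hB2 (by omega)
        omega
      · obtain rfl : x = a 2 := by omega
        exact not_B 2 (by omega) (by omega) hx
      · obtain rfl : x = a 1 := by omega
        exact not_B 1 (by omega) (by omega) hx
      · have := sidon_add i hi
        have hB := block (a i - a 2) (by omega) (by omega) (by omega)
        have := hsum i hi 2 (by omega) 0 _ hB0 hB (by omega)
        omega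
    · exact hmid 2 (by omega) 1 (by omega) 1 (by omega) _ hB2 (by omega)
    · have hB := block (b - a 2) (by omega) (by omega) (by omega)
      exact hmid 2 (by omega) 0 (by omega) 0 (by omega) _ hB (by omega)
  have hba' : b < a 2 := by
    refine lt_of_le_of_ne hba fun h => ?_
    exact hmid 2 (by omega) 0 (by omega) 0 (by omega) _ hB0 (by omega)
  -- Everything below the midpoint of the first two terms is covered by the first two translates.
  have half : ∀ n : ℕ, 2 * (n : ℤ) < 2 * b + a 1 → (n : ℤ) ≠ b → B n ∨ B (n - a 1) := by
    intro n
    induction n using Nat.strong_induction_on with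
    | _ n ih =>
    intro hn hnb
    rcases hcover n (by omega) (by omega) with ⟨i, hi, x, hx, h⟩ | ⟨i, hi, j, hj, h⟩
    · have := hBnonneg x hx
      have key : a 2 ≤ n → B n ∨ B (n - a 1) := by
        intro h2
        exfalso
        rcases h2.lt_or_eq with h2 | h2
        · have h3 := ih (a 2).toNat (by omega) (by omega) (by omega)
          rw [Int.toNat_of_nonneg (by omega)] at h3
          rcases h3 with h3 | h3
          · exact not_B 2 (by omega) (by omega) h3
          · have := hsum 1 (by omega) 2 (by omega) _ 0 h3 hB0 (by omega)
            omega
        · obtain ⟨e, he⟩ := he1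
          have hB := block (b + e - a 2) (by omega) (by omega) (by omega)
          exact hmid 2 (by omega) 0 (by omega) 1 (by omega) _ hB (by omega)
      rcases index i hi with rfl | rfl | rfl | ⟨_, _⟩
      · left; rwa [h, ha0, zero_add]
      · right; rwa [h, add_sub_cancel_left]
      all_goals exact key (by omega)
    · have := anonneg i hi
      have := anonneg j hj
      rcases index i hi with rfl | rfl | rfl | ⟨_, _⟩ <;>
        rcases index j hj with rfl | rfl | rfl | ⟨_, _⟩ <;> omega
  have covered : ∀ p, 0 ≤ p → p ≤ 2 * b + a 1 →
      (B p ∨ B (p - a 1)) ∨ 2 * p = 2 * b ∨ 2 * p = 2 * b + a 1 ∨ 2 * p = 2 * b + 2 * a 1 := by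
    intro p hp hp'
    rcases lt_trichotomy (2 * p) (2 * b + a 1) with h | h | h
    · by_cases hpb : p = b
      · omega
      · have := half p.toNat (by omega) (by omega)
        rw [Int.toNat_of_nonneg hp] at this
        exact Or.inl this
    · omega
    · by_cases hpb : p = b + a 1
      · omega
      · have := half (2 * b + a 1 - p).toNat (by omega) (by omega)
        rw [Int.toNat_of_nonneg (by omega)] at this
        rcases this with h | h
        · have := hBsymm _ h
          rw [show 2 * b - (2 * b + a 1 - p) = p - a 1 by ring] at this
          exact Or.inl (Or.inr this)
        · have := hBsymm _ h
          rw [show 2 * b - (2 * b + a 1 - p - a 1) = p by ring] at this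
          exact Or.inl (Or.inl this)
  have hfar : 2 * b + a 1 < a 2 := by
    by_contra! hle
    rcases covered (a 2) (by omega) hle with (h | h) | h | h | h
    · exact not_B 2 (by omega) (by omega) h
    · have := hsum 1 (by omega) 2 (by omega) _ 0 h hB0 (by omega)
      omega
    · exact hmid 2 (by omega) 0 (by omega) 0 (by omega) _ hB0 (by omega)
    · exact hmid 2 (by omega) 0 (by omega) 1 (by omega) _ hB0 (by omega)
    · exact hmid 2 (by omega) 1 (by omega) 1 (by omega) _ hB0 (by omega)
  have hBle : ∀ x, B x → x ≤ 2 * b := by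
    intro x hx
    have := hBnonneg _ (hBsymm x hx)
    omega
  have beyond : ∀ p, 2 * b + a 1 < p → p < a 2 →
      ∃ i < k, ∃ j < k, i ≤ j ∧ 2 * p = 2 * b + a i + a j := by
    intro p hp hp2
    rcases hcover p (by omega) (by omega) with ⟨i, hi, x, hx, h⟩ | ⟨i, hi, j, hj, h⟩
    · have := hBle x hx
      have := hBnonneg x hx
      rcases index i hi with rfl | rfl | rfl | ⟨_, _⟩ <;> omega
    · rcases le_total i j with hij | hij
      · exact ⟨i, hi, j, hj, hij, h⟩
      · exact ⟨j, hj, i, hi, hij, by omega⟩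
  have ha2 : a 2 = 2 * b + 2 * a 1 + 2 := by
    have hge : 2 * b + a 1 + 1 < a 2 := by omega
    obtain ⟨i, hi, j, hj, hij, h⟩ := beyond _ (by omega) hge
    have hj2 : a 2 ≤ a j := by
      have := anonneg i hi
      rcases index j hj with rfl | rfl | rfl | ⟨_, _⟩ <;>
        rcases index i hi with rfl | rfl | rfl | ⟨_, _⟩ <;> omega
    -- A smaller `a 2` would put its midpoint with `0` inside the covered segment.
    have hlow : 2 * b + 2 * a 1 + 2 ≤ a 2 := by
      by_contra! hlt
      obtain ⟨e, he⟩ := he2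
      rcases covered (b + e) (by omega) (by omega) with (h | h) | h | h | h
      · exact hmid 0 (by omega) 0 (by omega) 2 (by omega) _ h (by omega)
      · exact hmid 1 (by omega) 0 (by omega) 2 (by omega) _ h (by omega)
      · omega
      · omega
      · omega
    have := anonneg i hi
    omega
  have hd2 : a 1 = 2 := by
    by_contra hne
    obtain ⟨i, hi, j, hj, hij, h⟩ := beyond (2 * b + a 1 + 2) (by omega) (by omega)
    have hj2 : a j = a 2 + 2 := by
      rcases index i hi with rfl | rfl | rfl | ⟨_, _⟩ <;>
        rcases index j hj with rfl | rfl | rfl | ⟨_, _⟩ <;> omega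
    have hj3 : j ≠ 2 := by
      rintro rfl
      omega
    have hpair : ∃ x, B x ∧ B (x + 2) := by
      rcases (by omega : b = 1 ∨ b = 2 ∨ 3 ≤ b) with rfl | rfl | hb3
      · exact ⟨0, hB0, hBsymm 0 hB0⟩
      · have hB := block 1 (by omega) (by omega) (by omega)
        exact ⟨1, hB, hBsymm 1 hB⟩
      · exact ⟨0, hB0, block 2 (by omega) (by omega) (by omega)⟩
    obtain ⟨x, hx, hx2⟩ := hpair
    exact hj3 (hsum j hj 2 (by omega) x (x + 2) hx hx2 (by omega))
  obtain ⟨i, hi, j, hj, hij, h⟩ := beyond (2 * b + 5) (by omega) (by omega)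
  have hj2 : a j = 2 * b + 10 := by
    have := sidon_add j hj
    rcases index i hi with rfl | rfl | rfl | ⟨_, _⟩ <;>
      rcases index j hj with rfl | rfl | rfl | ⟨_, _⟩ <;> omega
  exact hmid 2 (by omega) 1 (by omega) j hj _ hB0 (by omega)

/-- Index set of the expressions `αᵢ + βⱼ`, `αᵢ - βⱼ`, `(αᵢ + αⱼ)/2` with `i ≤ j`. -/
def scIndex (k l : ℕ) : Finset ((ℕ × ℕ ⊕ ℕ × ℕ) ⊕ (Σ _ : ℕ, ℕ)) :=
  ((Finset.range k ×ˢ Finset.range l).disjSum (Finset.range k ×ˢ Finset.range l)).disjSum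
    ((Finset.range k).sigma fun j => Finset.range (j + 1))

/-- The expression with a given index; midpoints are rounded down. -/
def scValue (α β : ℕ → ℤ) : (ℕ × ℕ ⊕ ℕ × ℕ) ⊕ (Σ _ : ℕ, ℕ) → ℤ
  | .inl (.inl p) => α p.1 + β p.2
  | .inl (.inr p) => α p.1 - β p.2
  | .inr p => (α p.2 + α p.1) / 2

/-- The expression with a given index is an integer before rounding. -/
def scIntegral (α : ℕ → ℤ) : (ℕ × ℕ ⊕ ℕ × ℕ) ⊕ (Σ _ : ℕ, ℕ) → Prop
  | .inl _ => True
  | .inr p => 2 ∣ α p.2 + α p.1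

theorem card_scIndex (k l : ℕ) : (scIndex k l).card = 2 * k * l + k * (k + 1) / 2 := by
  have h : ∑ j ∈ Finset.range k, (j + 1) = k * (k + 1) / 2 := by
    have h1 := Finset.sum_range_succ' (fun j => j) k
    have h2 := Finset.sum_range_id (k + 1)
    simp only [add_zero] at h1
    rw [← h1, h2, Nat.add_sub_cancel, mul_comm]
  simp only [scIndex, Finset.card_disjSum, Finset.card_product, Finset.card_sigma,
    Finset.card_range, h]
  ring

/-- If `SC` fills the whole interval then, by counting, all midpoints are integers and all
expressions have different values. -/
theorem integral_and_injOn_of_SC_eq (k l : ℕ) (α β : ℕ → ℤ)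
    (h : SC k l α β = Set.Icc (1 : ℤ) ((2 * k * l + k * (k + 1) / 2 : ℕ) : ℤ)) :
    (∀ s ∈ scIndex k l, scIntegral α s) ∧ Set.InjOn (scValue α β) (scIndex k l) := by
  classical
  set J := (scIndex k l).filter (scIntegral α) with hJ
  have hsub : Finset.Icc (1 : ℤ) ((2 * k * l + k * (k + 1) / 2 : ℕ) : ℤ) ⊆
      J.image (scValue α β) := by
    intro t ht
    have ht' : t ∈ SC k l α β := by rw [h]; exact Finset.mem_Icc.mp ht
    rw [Finset.mem_image]
    rcases ht' with ⟨i, hi, j, hj, rfl⟩ | ⟨i, hi, j, hj, rfl⟩ | ⟨i, j, hij, hj, ht⟩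
    · exact ⟨.inl (.inl (i, j)), by simp [hJ, scIndex, scIntegral, hi, hj], rfl⟩
    · exact ⟨.inl (.inr (i, j)), by simp [hJ, scIndex, scIntegral, hi, hj], rfl⟩
    · refine ⟨.inr ⟨j, i⟩, ?_, ?_⟩
      · simp only [hJ, scIndex, scIntegral, Finset.mem_filter, Finset.inr_mem_disjSum,
          Finset.mem_sigma, Finset.mem_range]
        exact ⟨⟨hj, by omega⟩, t, ht.symm⟩
      · simp only [scValue]
        omega
  have h1 := Finset.card_le_card hsub
  have h2 : (J.image (scValue α β)).card ≤ J.card := Finset.card_image_le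
  have h3 : J.card ≤ (scIndex k l).card := Finset.card_filter_le _ _
  rw [Int.card_Icc, add_sub_cancel_right, Int.toNat_natCast, ← card_scIndex] at h1
  have hJeq : J = scIndex k l :=
    Finset.eq_of_subset_of_card_le (Finset.filter_subset _ _) (h1.trans h2)
  refine ⟨fun s hs => ?_, ?_⟩
  · rw [← hJeq] at hs
    exact (Finset.mem_filter.mp hs).2
  · rw [← hJeq]
    exact Finset.card_image_iff.mp (le_antisymm h2 (h3.trans h1))

/-- For `k ≥ 3` and `l ≥ 1` one never has `S_C(α,β) = {1, …, d}` with
`d = 2kl + k(k+1)/2`: there are no irreducible equivariant Ulrich bundles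
on `IGr(k, 2n)` for `2 < k < n`. -/
theorem stmt3 (k l : ℕ) (hk : 3 ≤ k) (hl : 1 ≤ l) (α β : ℕ → ℤ)
    (hα : ∀ i j, i < j → j < k → α j < α i)
    (hβ : ∀ i j, i < j → j < l → β j < β i)
    (hβpos : ∀ j < l, 0 < β j) :
    SC k l α β ≠ Set.Icc (1 : ℤ) ((2 * k * l + k * (k + 1) / 2 : ℕ) : ℤ) := by
  intro h
  obtain ⟨hint, hinj⟩ := integral_and_injOn_of_SC_eq k l α β h
  set d : ℤ := ((2 * k * l + k * (k + 1) / 2 : ℕ) : ℤ)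
  have hmem : ∀ t, t ∈ SC k l α β ↔ 1 ≤ t ∧ t ≤ d := fun t => by rw [h]; rfl
  have mem_plus : ∀ i < k, ∀ j < l, (.inl (.inl (i, j))) ∈ scIndex k l := by
    intro i hi j hj; simp [scIndex, hi, hj]
  have mem_minus : ∀ i < k, ∀ j < l, (.inl (.inr (i, j))) ∈ scIndex k l := by
    intro i hi j hj; simp [scIndex, hi, hj]
  have mem_mid : ∀ i j, i ≤ j → j < k → (.inr ⟨j, i⟩) ∈ scIndex k l := by
    intro i j hij hj
    simp only [scIndex, Finset.inr_mem_disjSum, Finset.mem_sigma, Finset.mem_range]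
    omega
  have parity : ∀ i j, i ≤ j → j < k → 2 ∣ α i + α j :=
    fun i j hij hj => hint _ (mem_mid i j hij hj)
  have hβ0 : ∀ j < l, β j ≤ β 0 := by
    intro j hj
    rcases Nat.eq_zero_or_pos j with rfl | h0
    · rfl
    · exact (hβ 0 j h0 hj).le
  have hα0 : ∀ i < k, α i ≤ α 0 := by
    intro i hi
    rcases Nat.eq_zero_or_pos i with rfl | h0
    · rfl
    · exact (hα 0 i h0 hi).le
  have hb := hβpos 0 hl
  have htop : α 0 + β 0 = d := by
    have hle : α 0 + β 0 ≤ d :=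
      ((hmem _).mp (Or.inl ⟨0, by omega, 0, hl, rfl⟩)).2
    have hbot : 1 ≤ α 0 - β 0 :=
      ((hmem _).mp (Or.inr (Or.inl ⟨0, by omega, 0, hl, rfl⟩))).1
    rcases (hmem d).mpr ⟨by omega, le_rfl⟩ with ⟨i, hi, j, hj, hd⟩ | ⟨i, hi, j, hj, hd⟩ |
      ⟨i, j, hij, hj, hd⟩
    · have := hα0 i hi; have := hβ0 j hj; omega
    · have := hα0 i hi; have := hβpos j hj; omega
    · have := hα0 i (by omega); have := hα0 j hj; omega
  have hbot : 1 ≤ α 2 - β 0 :=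
    ((hmem _).mp (Or.inr (Or.inl ⟨2, by omega, 0, hl, rfl⟩))).1
  have mid_inj : ∀ i j m n, i ≤ j → j < k → m ≤ n → n < k → α i + α j = α m + α n →
      i = m ∧ j = n := by
    intro i j m n hij hj hmn hn he
    have := hinj (mem_mid i j hij hj) (mem_mid m n hmn hn) (by simp only [scValue]; omega)
    simp only [Sum.inr.injEq, Sigma.mk.injEq, heq_eq_eq] at this
    exact ⟨this.2, this.1⟩
  refine false_of_sums_and_midpoints_tile k hk (fun i => α 0 - α i)
    (fun x => ∃ j < l, x = β 0 - β j ∨ x = β 0 + β j) (β 0) (by omega) (by simp) ?_ ?_ ?_ ?_ ?_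
    ?_ ?_ ?_ ?_
  · intro i j hij hj
    have := hα i j hij hj
    omega
  · intro i hi
    have := parity 0 i (by omega) hi
    omega
  · exact ⟨0, hl, Or.inl (by ring)⟩
  · rintro x ⟨j, hj, rfl | rfl⟩
    · exact ⟨j, hj, Or.inr (by ring)⟩
    · exact ⟨j, hj, Or.inl (by ring)⟩
  · rintro x ⟨j, hj, rfl | rfl⟩
    · have := hβ0 j hj; omega
    · have := hβpos j hj; omega
  · intro p hp hp2
    rcases (hmem (d - p)).mpr ⟨by omega, by omega⟩ with ⟨i, hi, j, hj, hd⟩ | ⟨i, hi, j, hj, hd⟩ |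
      ⟨i, j, hij, hj, hd⟩
    · exact Or.inl ⟨i, hi, β 0 - β j, ⟨j, hj, Or.inl rfl⟩, by omega⟩
    · exact Or.inl ⟨i, hi, β 0 + β j, ⟨j, hj, Or.inr rfl⟩, by omega⟩
    · exact Or.inr ⟨i, by omega, j, hj, by omega⟩
  · rintro i hi j hj x y ⟨m, hm, rfl | rfl⟩ ⟨n, hn, rfl | rfl⟩ he
    · have := hinj (mem_plus i hi m hm) (mem_plus j hj n hn) (by simp only [scValue]; omega)
      simp only [Sum.inl.injEq, Prod.mk.injEq] at this
      exact this.1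
    · have := hinj (mem_plus i hi m hm) (mem_minus j hj n hn) (by simp only [scValue]; omega)
      simp at this
    · have := hinj (mem_minus i hi m hm) (mem_plus j hj n hn) (by simp only [scValue]; omega)
      simp at this
    · have := hinj (mem_minus i hi m hm) (mem_minus j hj n hn) (by simp only [scValue]; omega)
      simp only [Sum.inl.injEq, Sum.inr.injEq, Prod.mk.injEq] at this
      exact this.1
  · have ordered : ∀ i < k, ∀ j m, j ≤ m → m < k →
        ∀ x, (∃ j < l, x = β 0 - β j ∨ x = β 0 + β j) →
        2 * (α 0 - α i + x) ≠ 2 * β 0 + (α 0 - α j) + (α 0 - α m) := by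
      rintro i hi j m hjm hm x ⟨n, hn, rfl | rfl⟩ he
      · have := hinj (mem_plus i hi n hn) (mem_mid j m hjm hm) (by simp only [scValue]; omega)
        simp at this
      · have := hinj (mem_minus i hi n hn) (mem_mid j m hjm hm) (by simp only [scValue]; omega)
        simp at this
    intro i hi j hj m hm x hx he
    rcases le_total j m with hjm | hjm
    · exact ordered i hi j m hjm hm x hx he
    · exact ordered i hi m j hjm hj x hx (by linarith)
  · intro i j m n hij hj hmn hn he
    exact mid_inj i j m n hij hj hmn hn (by linarith)
end

section
/- Let n ≥ 2, let k = 2, l = n − 2, and let α₁ > α₂ be integers and β₁ > β₂ > … > β_l > 0 be integers. Then S_C(α,β) = {1, 2, …, 4n−5} if and only if there exist integers p ≥ 1 and q ≥ 0 with n − 1 = p(2q+1) such that α₁ = 2n−2+p, α₂ = 2n−2−p, β_{2pm+s} = 2n−2−(4m+1)p−s for all 0 ≤ m ≤ q−1 and 1 ≤ s ≤ 2p, and β_{2pq+s} = p−s for all 1 ≤ s ≤ p−1. (This classifies the irreducible equivariant Ulrich bundles on the symplectic Grassmannian of planes IGr(2, 2n); the corresponding weight is λ = (n−2+p, n−1−p,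 2pq,…,2pq (2p times), 2p(q−1),…,2p(q−1) (2p times), …, 2p,…,2p (2p times), 0,…,0 (p−1 times)).) -/
/-- The symmetric set `{0} ∪ {±βⱼ : j < l}`. -/
def signedRange (l : ℕ) (β : ℕ → ℤ) : Set ℤ :=
  {y | y = 0 ∨ ∃ j < l, y = β j ∨ y = -β j}

theorem zero_mem_signedRange (l : ℕ) (β : ℕ → ℤ) : 0 ∈ signedRange l β := Or.inl rfl

theorem neg_mem_signedRange {l : ℕ} {β : ℕ → ℤ} {y : ℤ} (h : y ∈ signedRange l β) :
    -y ∈ signedRange l β := by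
  rcases h with rfl | ⟨j, hj, rfl | rfl⟩
  · exact Or.inl neg_zero
  · exact Or.inr ⟨j, hj, Or.inr rfl⟩
  · exact Or.inr ⟨j, hj, Or.inl (neg_neg _)⟩

theorem mem_SC_two {l : ℕ} {α β : ℕ → ℤ} {t : ℤ} :
    t ∈ SC 2 l α β ↔
      t - α 0 ∈ signedRange l β ∨ t - α 1 ∈ signedRange l β ∨ 2 * t = α 0 + α 1 := by
  constructor
  · rintro (⟨i, hi, j, hj, rfl⟩ | ⟨i, hi, j, hj, rfl⟩ | ⟨i, j, hij, hj, h⟩)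
    · interval_cases i
      · exact Or.inl (Or.inr ⟨j, hj, Or.inl (by ring)⟩)
      · exact Or.inr (Or.inl (Or.inr ⟨j, hj, Or.inl (by ring)⟩))
    · interval_cases i
      · exact Or.inl (Or.inr ⟨j, hj, Or.inr (by ring)⟩)
      · exact Or.inr (Or.inl (Or.inr ⟨j, hj, Or.inr (by ring)⟩))
    · interval_cases j
      · obtain rfl : i = 0 := by omega
        exact Or.inl (Or.inl (by omega))
      · interval_cases i
        · exact Or.inr (Or.inr h)
        · exact Or.inr (Or.inl (Or.inl (by omega)))
  · rintro ((h | ⟨j, hj, h | h⟩) | (h | ⟨j, hj, h | h⟩) | h)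
    · exact Or.inr (Or.inr ⟨0, 0, le_rfl, by omega, by omega⟩)
    · exact Or.inl ⟨0, by omega, j, hj, by omega⟩
    · exact Or.inr (Or.inl ⟨0, by omega, j, hj, by omega⟩)
    · exact Or.inr (Or.inr ⟨1, 1, le_rfl, by omega, by omega⟩)
    · exact Or.inl ⟨1, by omega, j, hj, by omega⟩
    · exact Or.inr (Or.inl ⟨1, by omega, j, hj, by omega⟩)
    · exact Or.inr (Or.inr ⟨0, 1, by omega, by omega, h⟩)

/-- A strictly decreasing sequence of length `l` whose values are among those of another strictly
decreasing sequence of length `l` coincides with it. -/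
theorem eq_of_strictAnti_of_subset {l : ℕ} {f g : ℕ → ℤ}
    (hf : ∀ i j, i < j → j < l → f j < f i) (hg : ∀ i j, i < j → g j < g i)
    (hfg : ∀ j < l, ∃ i < l, f j = g i) : ∀ j < l, f j = g j := by
  choose! σ hσl hσ using hfg
  have hmono : ∀ i j, i < j → j < l → σ i < σ j := by
    intro i j hij hj
    have h := hf i j hij hj
    rw [hσ i (hij.trans hj), hσ j hj] at h
    by_contra! hle
    rcases hle.lt_or_eq with hlt | heq
    · exact absurd (hg _ _ hlt) h.not_gt
    · rw [heq] at h
      exact h.false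
  have hlow : ∀ j < l, j ≤ σ j := by
    intro j
    induction j with
    | zero => exact fun _ => Nat.zero_le _
    | succ j ih =>
      intro hj
      have := ih (by omega)
      have := hmono j (j + 1) (by omega) hj
      omega
  have hup : ∀ k j, j + k + 1 = l → σ j ≤ j := by
    intro k
    induction k with
    | zero =>
      intro j hj
      have := hσl j (by omega)
      omega
    | succ k ih =>
      intro j hj
      have := ih (j + 1) (by omega)
      have := hmono j (j + 1) (by omega) (by omega)
      omega
  intro j hj
  have h₁ := hlow j hj
  have h₂ := hup (l - j - 1) j (by omega)
  rw [hσ j hj, le_antisymm h₂ h₁]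

/-- The decreasing sequence formed by blocks of `2p` consecutive integers starting at
`2l + 1 - p`, separated by gaps of length `2p`. -/
def blockSeq (l p : ℕ) (j : ℕ) : ℤ :=
  2 * l + 1 - p - j - 2 * p * ((j / (2 * p) : ℕ) : ℤ)

theorem blockSeq_lt {l p i j : ℕ} (h : i < j) : blockSeq l p j < blockSeq l p i := by
  have h₁ : ((i / (2 * p) : ℕ) : ℤ) ≤ ((j / (2 * p) : ℕ) : ℤ) := by
    exact_mod_cast Nat.div_le_div_right h.le
  have h₂ := mul_le_mul_of_nonneg_left h₁ (by positivity : (0 : ℤ) ≤ 2 * p)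
  unfold blockSeq
  omega

theorem blockSeq_add {l p m r : ℕ} (hr : r < 2 * p) :
    blockSeq l p (2 * p * m + r) = 2 * l + 1 - p - 4 * p * m - r := by
  have : (2 * p * m + r) / (2 * p) = m := by
    rw [Nat.mul_add_div (by omega), Nat.div_eq_of_lt hr, add_zero]
  rw [blockSeq, this]
  push_cast
  ring

theorem exists_blockSeq_eq {l p q m r : ℕ} {y : ℤ} (hl : l + 1 = p * (2 * q + 1))
    (hr : r < 2 * p) (hy : 0 < y) (h : y = 2 * l + 1 - p - 4 * p * m - r) :
    ∃ i < l, y = blockSeq l p i := by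
  refine ⟨2 * p * m + r, ?_, by rw [blockSeq_add hr, h]⟩
  have hl' : (l : ℤ) + 1 = p * (2 * q + 1) := by exact_mod_cast hl
  have hp : (0 : ℤ) < p := by omega
  zify
  rcases lt_trichotomy m q with hm | rfl | hm
  · have hm' : (m : ℤ) + 1 ≤ q := by exact_mod_cast hm
    have hr' : (r : ℤ) < 2 * p := by exact_mod_cast hr
    nlinarith
  · nlinarith
  · have hm' : (q : ℤ) + 1 ≤ m := by exact_mod_cast hm
    nlinarith

theorem blockSeq_iff {l p q : ℕ} {β : ℕ → ℤ} (hp : 1 ≤ p) (hl : l + 1 = p * (2 * q + 1)) :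
    (∀ j < l, β j = blockSeq l p j) ↔
      (∀ m s : ℕ, m < q → 1 ≤ s → s ≤ 2 * p →
        β (2 * p * m + s - 1) = 2 * ((l : ℤ) + 2) - 2 - (4 * (m : ℤ) + 1) * p - s) ∧
      (∀ s : ℕ, 1 ≤ s → s ≤ p - 1 → β (2 * p * q + s - 1) = (p : ℤ) - s) := by
  have hl₁ : l + 1 = 2 * p * q + p := by rw [hl]; ring
  have hl₂ : (l : ℤ) + 1 = 2 * p * q + p := by exact_mod_cast hl₁
  constructor
  · intro h
    constructor
    · intro m s hm hs hsp
      obtain ⟨r, rfl⟩ : ∃ r, s = r + 1 := ⟨s - 1, by omega⟩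
      have hlt : 2 * p * m + r < l := by
        have := Nat.mul_le_mul_left (2 * p) (Nat.succ_le_of_lt hm)
        rw [Nat.succ_eq_add_one, mul_add] at this
        omega
      rw [← add_assoc, Nat.add_sub_cancel, h _ hlt, blockSeq_add (by omega)]
      push_cast
      ring
    · intro s hs hsp
      obtain ⟨r, rfl⟩ : ∃ r, s = r + 1 := ⟨s - 1, by omega⟩
      rw [← add_assoc, Nat.add_sub_cancel, h _ (by omega), blockSeq_add (by omega)]
      push_cast
      linear_combination 2 * hl₂
  · rintro ⟨h₁, h₂⟩ j hj
    have hr : j % (2 * p) < 2 * p := Nat.mod_lt _ (by omega)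
    have hj' := Nat.div_add_mod j (2 * p)
    generalize j / (2 * p) = m at hj'
    generalize j % (2 * p) = r at hr hj'
    subst hj'
    rw [blockSeq_add hr]
    rcases lt_trichotomy m q with hm | rfl | hm
    · have := h₁ m (r + 1) hm (by omega) (by omega)
      rw [← add_assoc, Nat.add_sub_cancel] at this
      rw [this]
      push_cast
      ring
    · have := h₂ (r + 1) (by omega) (by omega)
      rw [← add_assoc, Nat.add_sub_cancel] at this
      rw [this]
      push_cast
      linear_combination -2 * hl₂
    · have := Nat.mul_le_mul_left (2 * p) (Nat.succ_le_of_lt hm)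
      rw [Nat.succ_eq_add_one, mul_add] at this
      omega

theorem exists_int_div_mod {p : ℕ} (hp : 1 ≤ p) {z : ℤ} (hz : 0 ≤ z) :
    ∃ k r : ℕ, r < 2 * p ∧ z = 2 * p * k + r := by
  lift z to ℕ using hz
  exact ⟨z / (2 * p), z % (2 * p), Nat.mod_lt _ (by omega),
    by exact_mod_cast (Nat.div_add_mod z (2 * p)).symm⟩

/-- A symmetric set `B ∋ 0` such that `[-N, N]` is the disjoint union of `B + p`, `B - p` and
`{0}` meets `[1 - p, N - p]` in blocks of `2p` integers, alternating with gaps of length `2p`. -/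
theorem mem_iff_even_of_tiling {B : Set ℤ} {p : ℕ} {N : ℤ} (hp : 1 ≤ p)
    (hcov : ∀ x : ℤ, (x - p ∈ B ∨ x + p ∈ B ∨ x = 0) ↔ |x| ≤ N)
    (hdisj : ∀ x : ℤ, x - p ∈ B → x + p ∉ B) (k r : ℕ) (y : ℤ) (hr : r < 2 * p)
    (hy : 1 - (p : ℤ) ≤ y) (h : N - p - y = 2 * p * k + r) : y ∈ B ↔ Even k := by
  have step (z : ℤ) (hz : 1 - (p : ℤ) ≤ z) (hzN : z ≤ N - p) :
      z ∈ B ↔ z + 2 * p ∉ B := by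
    have h₁ : z + p - p = z := by ring
    have h₂ : z + p + p = z + 2 * p := by ring
    have hc := (hcov (z + p)).2 (abs_le.2 ⟨by omega, by omega⟩)
    have hd := hdisj (z + p)
    rw [h₁, h₂] at hc hd
    have hne : z + p ≠ 0 := by omega
    tauto
  induction k generalizing y with
  | zero =>
    have hout : y + 2 * p ∉ B := fun hmem => by
      have := (abs_le.1 ((hcov (y + 2 * p + p)).1 (Or.inl (by simpa using hmem)))).2
      push_cast at h
      omega
    have := step y hy (by push_cast at h; omega)
    simp [this, hout]
  | succ k ih =>
    have hk : (0 : ℤ) ≤ 2 * p * (k : ℤ) := by positivity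
    have hexp : N - p - y = 2 * p * k + 2 * p + r := by rw [h]; push_cast; ring
    have ih' : y + 2 * p ∈ B ↔ Even k := ih (y + 2 * p) (by omega) (by omega)
    rw [step y hy (by omega), ih', Nat.even_add_one]

theorem eq_of_tiling {B : Set ℤ} {p : ℕ} {N : ℤ} (hp : 1 ≤ p) (h0 : 0 ∈ B)
    (hneg : ∀ y ∈ B, -y ∈ B)
    (hcov : ∀ x : ℤ, (x - p ∈ B ∨ x + p ∈ B ∨ x = 0) ↔ |x| ≤ N)
    (hdisj : ∀ x : ℤ, x - p ∈ B → x + p ∉ B) (hpB : (p : ℤ) ∉ B) :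
    ∃ q : ℕ, N + 1 = 2 * p * (2 * q + 1) := by
  have key := mem_iff_even_of_tiling hp hcov hdisj
  have hle : ∀ y ∈ B, y ≤ N - p := fun y hy => by
    have := (abs_le.1 ((hcov (y + p)).1 (Or.inl (by simpa using hy)))).2
    omega
  have hpN := hle 0 h0
  obtain ⟨k, r, hr, hkr⟩ := exists_int_div_mod hp hpN
  have hk : Even k := (key k r 0 hr (by omega) (by omega)).1 h0
  have hrp : r < p := by
    by_contra! hpr
    exact hpB ((key k (r - p) p (by omega) (by omega) (by push_cast [hpr]; omega)).2 hk)
  have hmem : (p : ℤ) - 1 ∈ B := by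
    have := hneg _ ((key k (r + p - 1) (1 - p) (by omega) le_rfl (by
      have : ((r + p - 1 : ℕ) : ℤ) = r + p - 1 := by omega
      rw [this]; omega)).2 hk)
    simpa using this
  have hrp' : r = p - 1 := by
    by_contra hne
    have hle' := hle _ hmem
    rcases k with _ | k
    · push_cast at hkr
      omega
    · have hexp : N - p = 2 * p * k + 2 * p + r := by
        rw [hkr]; push_cast; ring
      have := (key k (r + p + 1) (p - 1) (by omega) (by omega) (by push_cast; omega)).1 hmem
      exact (Nat.even_add_one.1 hk) this
  obtain ⟨q, rfl⟩ := hk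
  refine ⟨q, ?_⟩
  have hr' : (r : ℤ) = p - 1 := by omega
  rw [hr'] at hkr
  push_cast at hkr
  linear_combination hkr

theorem exists_finset_eq_signedRange (l : ℕ) (β : ℕ → ℤ) :
    ∃ B : Finset ℤ, (B : Set ℤ) = signedRange l β ∧ B.card ≤ 2 * l + 1 := by
  refine ⟨insert 0 ((Finset.range l).image β ∪ (Finset.range l).image fun j => -β j), ?_, ?_⟩
  · ext y
    simp only [signedRange, Finset.coe_insert, Finset.coe_union, Finset.coe_image,
      Finset.coe_range, Set.mem_insert_iff, Set.mem_union, Set.mem_image, Set.mem_Iio,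
      Set.mem_ofPred_eq]
    constructor
    · rintro (h | ⟨j, hj, rfl⟩ | ⟨j, hj, rfl⟩)
      · exact Or.inl h
      · exact Or.inr ⟨j, hj, Or.inl rfl⟩
      · exact Or.inr ⟨j, hj, Or.inr rfl⟩
    · rintro (h | ⟨j, hj, rfl | rfl⟩)
      · exact Or.inl h
      · exact Or.inr (Or.inl ⟨j, hj, rfl⟩)
      · exact Or.inr (Or.inr ⟨j, hj, rfl⟩)
  · refine (Finset.card_insert_le _ _).trans ?_
    have h₁ := Finset.card_union_le ((Finset.range l).image β)
      ((Finset.range l).image fun j => -β j)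
    have h₂ := Finset.card_image_le (s := Finset.range l) (f := β)
    have h₃ := Finset.card_image_le (s := Finset.range l) (f := fun j => -β j)
    rw [Finset.card_range] at h₂ h₃
    omega

/-- If `S_C(α,β)` is the full interval, then counting shows that its defining expressions are
pairwise distinct. -/
theorem disjoint_of_SC_eq {l : ℕ} {α β : ℕ → ℤ} {c : ℤ} (hc : α 0 + α 1 = 2 * c)
    (h : SC 2 l α β = Set.Icc (1 : ℤ) (4 * l + 3)) :
    (∀ t, t - α 0 ∈ signedRange l β → t - α 1 ∉ signedRange l β) ∧
      c - α 1 ∉ signedRange l β := by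
  obtain ⟨B, hB, hcard⟩ := exists_finset_eq_signedRange l β
  have hmem (y : ℤ) : y ∈ signedRange l β ↔ y ∈ B := by rw [← hB, Finset.mem_coe]
  have himg (a t : ℤ) : t ∈ B.image (· + a) ↔ t - a ∈ B := by
    rw [Finset.mem_image]
    exact ⟨fun ⟨y, hy, e⟩ => by rwa [← e, add_sub_cancel_right],
      fun ht => ⟨_, ht, sub_add_cancel _ _⟩⟩
  have hunion : B.image (· + α 0) ∪ insert c (B.image (· + α 1)) =
      Finset.Icc (1 : ℤ) (4 * l + 3) := by
    ext t
    have ht : t ∈ SC 2 l α β ↔ t ∈ Set.Icc (1 : ℤ) (4 * l + 3) := by rw [h]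
    have hct : 2 * t = α 0 + α 1 ↔ t = c := by omega
    rw [mem_SC_two, hmem, hmem, hct, Set.mem_Icc] at ht
    rw [Finset.mem_union, Finset.mem_insert, himg, himg, Finset.mem_Icc, ← ht,
      or_comm (a := t = c)]
  have hcardI : (Finset.Icc (1 : ℤ) (4 * l + 3)).card = 4 * l + 3 := by
    rw [Int.card_Icc]; omega
  have hsum := Finset.card_union_add_card_inter (B.image (· + α 0)) (insert c (B.image (· + α 1)))
  rw [hunion, hcardI] at hsum
  have h₀ : (B.image (· + α 0)).card ≤ B.card := Finset.card_image_le
  have h₁ : (B.image (· + α 1)).card ≤ B.card := Finset.card_image_le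
  have h₂ := Finset.card_insert_le c (B.image (· + α 1))
  constructor
  · intro t ht₀ ht₁
    rw [hmem, ← himg] at ht₀ ht₁
    have := Finset.card_pos.2
      ⟨t, Finset.mem_inter.2 ⟨ht₀, Finset.mem_insert_of_mem (b := c) ht₁⟩⟩
    omega
  · intro hcB
    rw [hmem, ← himg] at hcB
    rw [Finset.insert_eq_of_mem hcB] at hsum
    omega

theorem SC_add_eq {l : ℕ} {α β : ℕ → ℤ}
    (h : SC 2 l α β = Set.Icc (1 : ℤ) (4 * l + 3)) : α 0 + α 1 = 4 * l + 4 := by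
  have refl_mem (t : ℤ) (ht : t ∈ SC 2 l α β) : α 0 + α 1 - t ∈ SC 2 l α β := by
    rw [mem_SC_two] at ht ⊢
    rcases ht with ht | ht | ht
    · right; left
      convert neg_mem_signedRange ht using 1
      ring
    · left
      convert neg_mem_signedRange ht using 1
      ring
    · right; right
      omega
  rw [h] at refl_mem
  have h₁ := (refl_mem 1 ⟨le_rfl, by omega⟩).2
  have h₂ := (refl_mem (4 * l + 3) ⟨by omega, le_rfl⟩).1
  omega

theorem exists_blockSeq_of_SC_eq {l : ℕ} {α β : ℕ → ℤ} (hα : α 1 < α 0)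
    (hβ : ∀ i j, i < j → j < l → β j < β i) (hβpos : ∀ j < l, 0 < β j)
    (h : SC 2 l α β = Set.Icc (1 : ℤ) (4 * l + 3)) :
    ∃ p q : ℕ, 1 ≤ p ∧ l + 1 = p * (2 * q + 1) ∧ α 0 = 2 * l + 2 + p ∧ α 1 = 2 * l + 2 - p ∧
      ∀ j < l, β j = blockSeq l p j := by
  have hsum := SC_add_eq h
  obtain ⟨hdisj₀, hc⟩ := disjoint_of_SC_eq (c := 2 * l + 2) (by omega) h
  obtain ⟨p, hp₀⟩ := Int.eq_ofNat_of_zero_le (show 0 ≤ α 0 - (2 * l + 2) by omega)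
  have e₀ : α 0 = 2 * l + 2 + p := by omega
  have e₁ : α 1 = 2 * l + 2 - p := by omega
  have hp : 1 ≤ p := by omega
  have s₀ (x : ℤ) : x + (2 * l + 2) - α 0 = x - p := by rw [e₀]; ring
  have s₁ (x : ℤ) : x + (2 * l + 2) - α 1 = x + p := by rw [e₁]; ring
  have hdisj (x : ℤ) : x - p ∈ signedRange l β → x + p ∉ signedRange l β := by
    have := hdisj₀ (x + (2 * l + 2))
    rwa [s₀, s₁] at this
  have hpB : (p : ℤ) ∉ signedRange l β := by
    have := s₁ 0
    rw [zero_add, zero_add] at this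
    rwa [this] at hc
  have hcov (x : ℤ) : (x - p ∈ signedRange l β ∨ x + p ∈ signedRange l β ∨ x = 0) ↔
      |x| ≤ 2 * l + 1 := by
    have hx : x + (2 * l + 2) ∈ SC 2 l α β ↔
        x + (2 * l + 2) ∈ Set.Icc (1 : ℤ) (4 * l + 3) := by rw [h]
    have hx₀ : 2 * (x + (2 * l + 2)) = α 0 + α 1 ↔ x = 0 := by omega
    rw [mem_SC_two, s₀, s₁, hx₀, Set.mem_Icc] at hx
    rw [hx, abs_le]
    omega
  obtain ⟨q, hq⟩ := eq_of_tiling hp (zero_mem_signedRange l β)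
    (fun _ => neg_mem_signedRange) hcov hdisj hpB
  have hl : l + 1 = p * (2 * q + 1) := by
    zify
    linarith
  refine ⟨p, q, hp, hl, e₀, e₁, eq_of_strictAnti_of_subset hβ (fun _ _ => blockSeq_lt) ?_⟩
  intro j hj
  have hpos := hβpos j hj
  have hmem : β j ∈ signedRange l β := Or.inr ⟨j, hj, Or.inl rfl⟩
  have hle := (abs_le.1 ((hcov (β j + p)).1 (Or.inl (by simpa using hmem)))).2
  obtain ⟨k, r, hr, hkr⟩ := exists_int_div_mod hp (show 0 ≤ 2 * (l : ℤ) + 1 - p - β j by omega)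
  obtain ⟨m, rfl⟩ := (mem_iff_even_of_tiling hp hcov hdisj k r _ hr (by omega) hkr).1 hmem
  refine exists_blockSeq_eq (m := m) hl hr hpos ?_
  push_cast at hkr
  linarith

theorem SC_eq_of_blockSeq {l p q : ℕ} {α β : ℕ → ℤ} (hp : 1 ≤ p) (hl : l + 1 = p * (2 * q + 1))
    (hβpos : ∀ j < l, 0 < β j) (e₀ : α 0 = 2 * l + 2 + p) (e₁ : α 1 = 2 * l + 2 - p)
    (h : ∀ j < l, β j = blockSeq l p j) :
    SC 2 l α β = Set.Icc (1 : ℤ) (4 * l + 3) := by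
  have hpl : p ≤ l + 1 := hl ▸ Nat.le_mul_of_pos_right p (by omega)
  have hbound (y : ℤ) (hy : y ∈ signedRange l β) : |y| ≤ 2 * l + 1 - p := by
    rcases hy with rfl | ⟨j, hj, hy⟩
    · rw [abs_zero]; omega
    · have hpos := hβpos j hj
      have hub : β j ≤ 2 * l + 1 - p := by
        rw [h j hj, blockSeq]
        have : (0 : ℤ) ≤ 2 * p * ((j / (2 * p) : ℕ) : ℤ) := by positivity
        omega
      rw [abs_le]
      omega
  have hmem (y : ℤ) (m r : ℕ) (hr : r < 2 * p) (hy : 0 < y)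
      (hyr : y = 2 * l + 1 - p - 4 * p * m - r) : y ∈ signedRange l β := by
    obtain ⟨i, hi, e⟩ := exists_blockSeq_eq hl hr hy hyr
    exact Or.inr ⟨i, hi, Or.inl (e.trans (h i hi).symm)⟩
  have hl' : (l : ℤ) + 1 = p * (2 * q + 1) := by exact_mod_cast hl
  have hsmall (y : ℤ) (hy : 0 ≤ y) (hyp : y < p) : y ∈ signedRange l β := by
    rcases hy.eq_or_lt with rfl | hpos
    · exact zero_mem_signedRange l β
    · lift y to ℕ using hy
      refine hmem y q (p - 1 - y) (by omega) hpos ?_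
      have : ((p - 1 - y : ℕ) : ℤ) = p - 1 - y := by omega
      rw [this]
      linear_combination -2 * hl'
  have hcov (x : ℤ) (hx : 0 < x) (hxN : x ≤ 2 * l + 1) :
      x - p ∈ signedRange l β ∨ x + p ∈ signedRange l β := by
    obtain ⟨k, r, hr, hkr⟩ := exists_int_div_mod hp (sub_nonneg.2 hxN)
    rcases Nat.even_or_odd' k with ⟨m, rfl | rfl⟩
    · left
      push_cast at hkr
      rcases le_or_gt (x - p) 0 with hle | hpos
      · simpa using neg_mem_signedRange (hsmall (-(x - p)) (by omega) (by omega))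
      · exact hmem _ m r hr hpos (by linarith)
    · right
      push_cast at hkr
      exact hmem _ m r hr (by omega) (by linarith)
  ext t
  rw [mem_SC_two, Set.mem_Icc]
  constructor
  · rintro (ht | ht | ht)
    · have := abs_le.1 (hbound _ ht)
      omega
    · have := abs_le.1 (hbound _ ht)
      omega
    · omega
  · rintro ⟨ht₁, ht₂⟩
    have hflip (y : ℤ) : y ∈ signedRange l β → -y ∈ signedRange l β := neg_mem_signedRange
    rcases lt_trichotomy t (2 * l + 2) with hlt | heq | hgt
    · rcases hcov (2 * l + 2 - t) (by omega) (by omega) with hm | hm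
      · right; left
        convert hflip _ hm using 1
        omega
      · left
        convert hflip _ hm using 1
        omega
    · right; right
      omega
    · rcases hcov (t - (2 * l + 2)) (by omega) (by omega) with hm | hm
      · left
        convert hm using 1
        omega
      · right; left
        convert hm using 1
        omega

/-- Classification of irreducible equivariant Ulrich bundles on `IGr(2, 2n)`:
for `k = 2`, `l = n - 2`, integers `α₁ > α₂` and `β₁ > … > β_l > 0` (0-based
in Lean), one has `S_C(α,β) = {1, …, 4n-5}` iff there are integers `p ≥ 1`,
`q ≥ 0` with `n - 1 = p(2q+1)` such that `α₁ = 2n-2+p`, `α₂ = 2n-2-p`,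
`β_{2pm+s} = 2n-2-(4m+1)p-s` for `0 ≤ m ≤ q-1`, `1 ≤ s ≤ 2p`, and
`β_{2pq+s} = p-s` for `1 ≤ s ≤ p-1`. -/
theorem stmt4 (n : ℕ) (hn : 2 ≤ n) (α β : ℕ → ℤ)
    (hα : α 1 < α 0)
    (hβ : ∀ i j, i < j → j < n - 2 → β j < β i)
    (hβpos : ∀ j < n - 2, 0 < β j) :
    SC 2 (n - 2) α β = Set.Icc (1 : ℤ) (4 * (n : ℤ) - 5) ↔
    ∃ p q : ℕ, 1 ≤ p ∧ n - 1 = p * (2 * q + 1) ∧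
      α 0 = 2 * (n : ℤ) - 2 + p ∧ α 1 = 2 * (n : ℤ) - 2 - p ∧
      (∀ m s : ℕ, m < q → 1 ≤ s → s ≤ 2 * p →
        β (2 * p * m + s - 1) = 2 * (n : ℤ) - 2 - (4 * (m : ℤ) + 1) * p - s) ∧
      (∀ s : ℕ, 1 ≤ s → s ≤ p - 1 → β (2 * p * q + s - 1) = (p : ℤ) - s) := by
  obtain ⟨l, rfl⟩ : ∃ l, n = l + 2 := ⟨n - 2, by omega⟩
  have hd : 4 * ((l + 2 : ℕ) : ℤ) - 5 = 4 * l + 3 := by push_cast; ring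
  have hl : l + 2 - 1 = l + 1 := rfl
  rw [Nat.add_sub_cancel] at hβ hβpos ⊢
  rw [hd, hl]
  push_cast
  constructor
  · intro h
    obtain ⟨p, q, hp, hpq, e₀, e₁, hb⟩ := exists_blockSeq_of_SC_eq hα hβ hβpos h
    exact ⟨p, q, hp, hpq, by omega, by omega, (blockSeq_iff hp hpq).1 hb⟩
  · rintro ⟨p, q, hp, hpq, e₀, e₁, hb⟩
    exact SC_eq_of_blockSeq hp hpq hβpos (by omega) (by omega) ((blockSeq_iff hp hpq).2 hb)
end

section
/- Let k, l ≥ 1, let α₁ > α₂ > … > α_k and β₁ > β₂ > … > β_l > 0 be rational numbers all of which lie in ½ + ℤ (half-odd-integers). Define S(α,β) = {α_i + β_j} ∪ {α_i − β_j} ∪ {(α_i + α_j)/2 : 1 ≤ i ≤ j ≤ k and (α_i + α_j)/2 ∈ ℤ} ⊆ ℤ. Then S(α,β) has strictly fewer than d = 2kl + k(k+1)/2 elements; in particular S(α,β) ≠ {1, 2, …, d}. -/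
/-- For rational sequences `α`, `β`, the set of integers
`S(α,β) = {αᵢ + βⱼ} ∪ {αᵢ - βⱼ} ∪ {(αᵢ + αⱼ)/2 : i ≤ j, (αᵢ + αⱼ)/2 ∈ ℤ}`,
with 0-based indices `i < k`, `j < l`. -/
def SB (k l : ℕ) (α β : ℕ → ℚ) : Set ℤ :=
  {t | (∃ i < k, ∃ j < l, (t : ℚ) = α i + β j) ∨
       (∃ i < k, ∃ j < l, (t : ℚ) = α i - β j) ∨
       (∃ i j, i ≤ j ∧ j < k ∧ 2 * (t : ℚ) = α i + α j)}

/-- If no `α i` is an integer, then `S(α,β)` has at most `2kl + k(k-1)/2` elements: the diagonal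
terms `(αᵢ + αᵢ)/2` do not contribute. -/
theorem SB_subset_finset (k l : ℕ) (α β : ℕ → ℚ)
    (hα : ∀ i < k, ∀ t : ℤ, (t : ℚ) ≠ α i) :
    ∃ F : Finset ℤ, SB k l α β ⊆ F ∧ F.card ≤ 2 * k * l + ∑ j ∈ Finset.range k, j := by
  classical
  let P := Finset.range k ×ˢ Finset.range l
  let T := (Finset.range k).sigma fun j => Finset.range j
  let A := P.image fun p => ⌊α p.1 + β p.2⌋
  let B := P.image fun p => ⌊α p.1 - β p.2⌋
  let C := T.image fun p => ⌊(α p.2 + α p.1) / 2⌋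
  refine ⟨A ∪ (B ∪ C), ?_, ?_⟩
  · rintro t (⟨i, hi, j, hj, h⟩ | ⟨i, hi, j, hj, h⟩ | ⟨i, j, hij, hj, h⟩)
    · refine Finset.mem_union_left _ (Finset.mem_image.2 ⟨(i, j), by simp [P, hi, hj], ?_⟩)
      simp only [← h, Int.floor_intCast]
    · refine Finset.mem_union_right _ (Finset.mem_union_left _
        (Finset.mem_image.2 ⟨(i, j), by simp [P, hi, hj], ?_⟩))
      simp only [← h, Int.floor_intCast]
    · have hlt : i < j := by
        refine lt_of_le_of_ne hij ?_
        rintro rfl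
        exact hα i hj t (by linarith)
      refine Finset.mem_union_right _ (Finset.mem_union_right _
        (Finset.mem_image.2 ⟨⟨j, i⟩, by simp [T, hlt, hj], ?_⟩))
      have h' : (α i + α j) / 2 = (t : ℚ) := by linarith
      simp only [h', Int.floor_intCast]
  · have hP : P.card = k * l := by simp [P]
    have hT : T.card = ∑ j ∈ Finset.range k, j := by simp [T]
    have hA : A.card ≤ k * l := hP ▸ Finset.card_image_le
    have hB : B.card ≤ k * l := hP ▸ Finset.card_image_le
    have hC : C.card ≤ ∑ j ∈ Finset.range k, j := hT ▸ Finset.card_image_le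
    have h₁ := Finset.card_union_le A (B ∪ C)
    have h₂ := Finset.card_union_le B C
    rw [mul_assoc]
    omega

/-- If `α₁ > … > α_k` and `β₁ > … > β_l > 0` are all half-odd-integers, then
`S(α,β)` has strictly fewer than `d = 2kl + k(k+1)/2` elements; in particular
`S(α,β) ≠ {1, …, d}`. -/
theorem stmt6 (k l : ℕ) (hk : 1 ≤ k) (hl : 1 ≤ l) (α β : ℕ → ℚ)
    (hα : ∀ i j, i < j → j < k → α j < α i)
    (hβ : ∀ i j, i < j → j < l → β j < β i)
    (hβpos : ∀ j < l, 0 < β j)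
    (hαhalf : ∀ i < k, ∃ m : ℤ, α i = m + 1 / 2)
    (hβhalf : ∀ j < l, ∃ m : ℤ, β j = m + 1 / 2) :
    (SB k l α β).Finite ∧
    (SB k l α β).ncard < 2 * k * l + k * (k + 1) / 2 ∧
    SB k l α β ≠ Set.Icc (1 : ℤ) ((2 * k * l + k * (k + 1) / 2 : ℕ) : ℤ) := by
  have hne : ∀ i < k, ∀ t : ℤ, (t : ℚ) ≠ α i := by
    intro i hi t ht
    obtain ⟨m, hm⟩ := hαhalf i hi
    have h : ((2 * t : ℤ) : ℚ) = ((2 * m + 1 : ℤ) : ℚ) := by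
      push_cast
      linarith
    have h' : 2 * t = 2 * m + 1 := by exact_mod_cast h
    omega
  obtain ⟨F, hF, hcard⟩ := SB_subset_finset k l α β hne
  have hlt : (SB k l α β).ncard < 2 * k * l + k * (k + 1) / 2 := by
    have h₁ : (SB k l α β).ncard ≤ F.card := by
      rw [← Set.ncard_coe_finset]
      exact Set.ncard_le_ncard hF F.finite_toSet
    have h₂ := Finset.sum_range_succ (fun j => j) k
    have h₃ := Finset.sum_range_id (k + 1)
    rw [Nat.add_sub_cancel, mul_comm] at h₃
    omega
  refine ⟨F.finite_toSet.subset hF, hlt, fun h => hlt.ne ?_⟩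
  rw [h, ← Finset.coe_Icc, Set.ncard_coe_finset, Int.card_Icc]
  omega
end

section
/- Let n ≥ 2, let α ∈ ℚ and β₁ > β₂ > … > β_{n−1} > 0 be rationals such that α and all β_j lie in ℤ, or all lie in ½ + ℤ. Define S = {α + β_j : 1 ≤ j ≤ n−1} ∪ {α − β_j : 1 ≤ j ≤ n−1} ∪ ({α} ∩ ℤ) ⊆ ℤ. Then S = {1, 2, …, 2n−1} if and only if α = n and β_j = n − j for all j. (Equivalently: up to isomorphism, the spinor bundle, corresponding to λ = (½, ½, …, ½), is the only irreducible equivariant Ulrich bundle on the odd-dimensional quadric Q^{2n−1}.) -/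
/-- A finite strictly decreasing sequence of integer-valued rationals drops by at least one
at each step. -/
lemma add_le_of_integral_strictAnti {N : ℕ} {β : ℕ → ℚ}
    (hβ : ∀ i j, i < j → j < N → β j < β i)
    (hint : ∀ j < N, ∃ m : ℤ, β j = m) (i k : ℕ) (hik : i + k < N) :
    β (i + k) + k ≤ β i := by
  induction k with
  | zero => simp
  | succ k ih =>
    have hprev := ih (by omega)
    have hlt := hβ (i + k) (i + (k + 1)) (by omega) hik
    obtain ⟨a, ha⟩ := hint (i + k) (by omega)
    obtain ⟨b, hb⟩ := hint (i + (k + 1)) hik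
    rw [ha, hb] at hlt
    have hab : b + 1 ≤ a := by exact_mod_cast hlt
    have hab' : (b : ℚ) + 1 ≤ a := by exact_mod_cast hab
    rw [hb]
    rw [ha] at hprev
    push_cast
    linarith


/-- The spinor bundle is the only irreducible equivariant Ulrich bundle on
the odd quadric `Q^{2n-1}`: for rationals `α` and `β₁ > … > β_{n-1} > 0`
(0-based in Lean), all integers or all half-odd-integers, the set
`S = {α + βⱼ} ∪ {α - βⱼ} ∪ ({α} ∩ ℤ)` equals `{1, …, 2n-1}` iff `α = n` and
`βⱼ = n - j` for all `j` (math 1-based `j`). -/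
theorem stmt8 (n : ℕ) (hn : 2 ≤ n) (α : ℚ) (β : ℕ → ℚ)
    (hβ : ∀ i j, i < j → j < n - 1 → β j < β i)
    (hβpos : ∀ j < n - 1, 0 < β j)
    (hint : ((∃ m : ℤ, α = m) ∧ ∀ j < n - 1, ∃ m : ℤ, β j = m) ∨
            ((∃ m : ℤ, α = m + 1 / 2) ∧ ∀ j < n - 1, ∃ m : ℤ, β j = m + 1 / 2)) :
    {t : ℤ | (∃ j < n - 1, (t : ℚ) = α + β j ∨ (t : ℚ) = α - β j) ∨ (t : ℚ) = α}
      = Set.Icc (1 : ℤ) (2 * (n : ℤ) - 1) ↔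
    α = n ∧ ∀ j < n - 1, β j = (n : ℚ) - (j + 1) := by
  have hN : 0 < n - 1 := by omega
  constructor
  · intro hS
    have hmem : ∀ t : ℤ, ((∃ j < n - 1, (t : ℚ) = α + β j ∨ (t : ℚ) = α - β j) ∨ (t : ℚ) = α) ↔
        1 ≤ t ∧ t ≤ 2 * (n : ℤ) - 1 := fun t => Set.ext_iff.mp hS t
    have hβ₀ : ∀ j < n - 1, β j ≤ β 0 := by
      intro j hj
      rcases Nat.eq_zero_or_pos j with rfl | hpos
      · exact le_rfl
      · exact (hβ 0 j hpos hj).le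
    have hβ₀pos := hβpos 0 hN
    have hbound : ∀ t : ℤ, 1 ≤ t ∧ t ≤ 2 * (n : ℤ) - 1 → α - β 0 ≤ t ∧ (t : ℚ) ≤ α + β 0 := by
      intro t ht
      rcases (hmem t).mpr ht with ⟨j, hj, h | h⟩ | h
      · have := hβ₀ j hj
        have := hβpos j hj
        constructor <;> linarith
      · have := hβ₀ j hj
        have := hβpos j hj
        constructor <;> linarith
      · constructor <;> linarith
    obtain ⟨⟨p, hp⟩, q, hq⟩ : (∃ p : ℤ, (p : ℚ) = α + β 0) ∧ ∃ q : ℤ, (q : ℚ) = α - β 0 := by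
      rcases hint with ⟨⟨m, hm⟩, h⟩ | ⟨⟨m, hm⟩, h⟩ <;> obtain ⟨b, hb⟩ := h 0 hN
      · exact ⟨⟨m + b, by rw [hm, hb]; push_cast; ring⟩, m - b, by rw [hm, hb]; push_cast; ring⟩
      · exact ⟨⟨m + b + 1, by rw [hm, hb]; push_cast; ring⟩,
          m - b, by rw [hm, hb]; push_cast; ring⟩
    have hp' := (hmem p).mp (Or.inl ⟨0, hN, Or.inl hp⟩)
    have hq' := (hmem q).mp (Or.inl ⟨0, hN, Or.inr hq⟩)
    have hlow := (hbound 1 ⟨le_rfl, by omega⟩).1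
    have hhigh := (hbound (2 * (n : ℤ) - 1) ⟨by omega, le_rfl⟩).2
    rw [← hq] at hlow
    rw [← hp] at hhigh
    have hq1 : q = 1 := le_antisymm (by exact_mod_cast hlow) hq'.1
    have hpn : p = 2 * (n : ℤ) - 1 := le_antisymm hp'.2 (by exact_mod_cast hhigh)
    rw [hq1] at hq
    rw [hpn] at hp
    push_cast at hp hq
    have hα : α = n := by linarith
    refine ⟨hα, ?_⟩
    rcases hint with ⟨-, hβint⟩ | ⟨⟨m, hm⟩, -⟩
    · intro j hj
      have hupper := add_le_of_integral_strictAnti hβ hβint 0 j (by omega)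
      have hlower := add_le_of_integral_strictAnti hβ hβint j (n - 2 - j) (by omega)
      obtain ⟨b, hb⟩ := hβint (j + (n - 2 - j)) (by omega)
      have hbpos := hβpos (j + (n - 2 - j)) (by omega)
      rw [hb] at hbpos hlower
      have hb1 : (1 : ℤ) ≤ b := by exact_mod_cast hbpos
      have hb1' : (1 : ℚ) ≤ b := by exact_mod_cast hb1
      have hsub : ((n - 2 - j : ℕ) : ℚ) = n - 2 - j := by
        rw [Nat.cast_sub (by omega), Nat.cast_sub hn]
        norm_num
      rw [hsub] at hlower
      rw [zero_add] at hupper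
      linarith
    · have h2 : (2 * (n : ℤ) : ℚ) = 2 * m + 1 := by
        push_cast
        linarith
      have h2' : 2 * (n : ℤ) = 2 * m + 1 := by exact_mod_cast h2
      omega
  · rintro ⟨rfl, hβn⟩
    ext t
    simp only [Set.mem_ofPred_eq, Set.mem_Icc]
    constructor
    · rintro (⟨j, hj, h | h⟩ | h)
      · rw [hβn j hj] at h
        have : t = n + (n - (j + 1)) := by exact_mod_cast h
        omega
      · rw [hβn j hj] at h
        have : t = n - (n - (j + 1)) := by exact_mod_cast h
        omega
      · have : t = n := by exact_mod_cast h
        omega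
    · rintro ⟨h1, h2⟩
      rcases lt_trichotomy t n with h | h | h
      · obtain ⟨j, hj⟩ := Int.eq_ofNat_of_zero_le (show 0 ≤ t - 1 by omega)
        refine Or.inl ⟨j, by omega, Or.inr ?_⟩
        rw [hβn j (by omega), show t = j + 1 by omega]
        push_cast
        ring
      · exact Or.inr (by exact_mod_cast h)
      · obtain ⟨j, hj⟩ := Int.eq_ofNat_of_zero_le (show 0 ≤ 2 * (n : ℤ) - 1 - t by omega)
        refine Or.inl ⟨j, by omega, Or.inl ?_⟩
        rw [hβn j (by omega), show t = 2 * n - 1 - j by omega]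
        push_cast
        ring
end

section
/- Let k ≥ 1, l ≥ 1, let α₁ > α₂ > … > α_k and β₁, …, β_l be rationals with β₁ > β₂ > … > β_{l−1} > |β_l|, all entries of α and β lying in ℤ or all lying in ½ + ℤ. For t ∈ ℤ let v(t) ∈ ℚ^{k+l} be the vector with v(t)_i = α_i − t for 1 ≤ i ≤ k and v(t)_{k+j} = β_j for 1 ≤ j ≤ l. Then the following are equivalent: (a) v(t) has two coordinates with distinct indices that are equal, or two coordinates with distinct indices whose sum is 0; (b) t belongs to {α_i + β_j} ∪ {α_i − β_j} ∪ {(α_i + α_j)/2 : 1 ≤ i < j ≤ k and (α_i + α_j)/2 ∈ ℤ}. -/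
/-- The vector `v(t) ∈ ℚ^{k+l}`: the first `k` coordinates are `αᵢ - t`
(0-based indices `0, …, k-1`), the remaining `l` coordinates are `βⱼ`. -/
def vvecD (k : ℕ) (α β : ℕ → ℚ) (t : ℤ) (i : ℕ) : ℚ :=
  if i < k then α i - t else β (i - k)

/-- Under the type `Dₙ` dominance condition, each entry strictly exceeds the absolute value of
every later one. -/
theorem abs_lt_of_dominant {l : ℕ} {β : ℕ → ℚ}
    (hβ : ∀ i j, i < j → j + 1 < l → β j < β i)
    (hβl : 2 ≤ l → |β (l - 1)| < β (l - 2)) {i j : ℕ} (hij : i < j) (hj : j < l) :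
    |β j| < β i := by
  have hlast := hβl (by omega)
  have hle : ∀ m, m + 1 < l → β (l - 2) ≤ β m := fun m hm => by
    rcases (show m ≤ l - 2 by omega).eq_or_lt with rfl | h
    · exact le_rfl
    · exact (hβ _ _ h (by omega)).le
  rcases (show j + 1 ≤ l from hj).eq_or_lt with rfl | h
  · exact hlast.trans_le (hle i (by omega))
  · have hpos : 0 < β j := ((abs_nonneg _).trans_lt hlast).trans_le (hle j h)
    rw [abs_of_pos hpos]
    exact hβ i j hij h

theorem vvecD_of_lt {k i : ℕ} (α β : ℕ → ℚ) (t : ℤ) (h : i < k) :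
    vvecD k α β t i = α i - t :=
  if_pos h

theorem vvecD_add (k : ℕ) (α β : ℕ → ℚ) (t : ℤ) (j : ℕ) :
    vvecD k α β t (k + j) = β j := by
  simp [vvecD]

/-- Two distinct indices can be put in increasing order when testing for equal or opposite
entries. -/
theorem exists_eq_or_add_eq_zero_iff_lt (n : ℕ) (v : ℕ → ℚ) :
    ((∃ i < n, ∃ j < n, i ≠ j ∧ v i = v j) ∨ (∃ i < n, ∃ j < n, i ≠ j ∧ v i + v j = 0)) ↔
      ∃ i j, i < j ∧ j < n ∧ (v i = v j ∨ v i + v j = 0) := by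
  constructor
  · rintro (⟨i, hi, j, hj, hij, h⟩ | ⟨i, hi, j, hj, hij, h⟩) <;>
      rcases hij.lt_or_gt with hlt | hlt
    · exact ⟨i, j, hlt, hj, .inl h⟩
    · exact ⟨j, i, hlt, hi, .inl h.symm⟩
    · exact ⟨i, j, hlt, hj, .inr h⟩
    · exact ⟨j, i, hlt, hi, .inr (by rwa [add_comm])⟩
  · rintro ⟨i, j, hij, hj, h | h⟩
    · exact .inl ⟨i, hij.trans hj, j, hj, hij.ne, h⟩
    · exact .inr ⟨i, hij.trans hj, j, hj, hij.ne, h⟩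

/-- Singularity criterion in type `Dₙ`: for `α₁ > … > α_k` and
`β₁ > … > β_{l-1} > |β_l|`, all integers or all half-odd-integers, the vector
`v(t)` has two equal coordinates (distinct indices) or two coordinates
(distinct indices) summing to zero iff `t = αᵢ + βⱼ`, or `t = αᵢ - βⱼ`, or
`t = (αᵢ + αⱼ)/2 ∈ ℤ` for some `i < j`. (Indices 0-based.) -/
theorem stmt9 (k l : ℕ) (hk : 1 ≤ k) (hl : 1 ≤ l) (α β : ℕ → ℚ)
    (hα : ∀ i j, i < j → j < k → α j < α i)
    (hβ : ∀ i j, i < j → j + 1 < l → β j < β i)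
    (hβl : 2 ≤ l → |β (l - 1)| < β (l - 2))
    (hint : ((∀ i < k, ∃ m : ℤ, α i = m) ∧ ∀ j < l, ∃ m : ℤ, β j = m) ∨
            ((∀ i < k, ∃ m : ℤ, α i = m + 1 / 2) ∧
              ∀ j < l, ∃ m : ℤ, β j = m + 1 / 2))
    (t : ℤ) :
    ((∃ i < k + l, ∃ j < k + l, i ≠ j ∧ vvecD k α β t i = vvecD k α β t j) ∨
     (∃ i < k + l, ∃ j < k + l, i ≠ j ∧ vvecD k α β t i + vvecD k α β t j = 0)) ↔
    ((∃ i < k, ∃ j < l, (t : ℚ) = α i + β j) ∨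
     (∃ i < k, ∃ j < l, (t : ℚ) = α i - β j) ∨
     (∃ i j, i < j ∧ j < k ∧ 2 * (t : ℚ) = α i + α j)) := by
  rw [exists_eq_or_add_eq_zero_iff_lt]
  constructor
  · rintro ⟨i, j, hij, hj, h⟩
    rcases lt_or_ge j k with hjk | hjk
    · rw [vvecD_of_lt α β t (hij.trans hjk), vvecD_of_lt α β t hjk] at h
      have hlt := hα i j hij hjk
      rcases h with h | h
      · linarith
      · exact .inr (.inr ⟨i, j, hij, hjk, by linarith⟩)
    obtain ⟨b, rfl⟩ := Nat.exists_eq_add_of_le hjk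
    rw [vvecD_add] at h
    rcases lt_or_ge i k with hik | hik
    · rw [vvecD_of_lt α β t hik] at h
      rcases h with h | h
      · exact .inr (.inl ⟨i, hik, b, by omega, by linarith⟩)
      · exact .inl ⟨i, hik, b, by omega, by linarith⟩
    · obtain ⟨a, rfl⟩ := Nat.exists_eq_add_of_le hik
      rw [vvecD_add] at h
      have hab := abs_lt.mp
        (abs_lt_of_dominant hβ hβl (show a < b by omega) (show b < l by omega))
      rcases h with h | h <;> linarith [hab.1, hab.2]
  · rintro (⟨i, hi, j, hj, h⟩ | ⟨i, hi, j, hj, h⟩ | ⟨i, j, hij, hj, h⟩)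
    · refine ⟨i, k + j, by omega, by omega, .inr ?_⟩
      rw [vvecD_of_lt α β t hi, vvecD_add]
      linarith
    · refine ⟨i, k + j, by omega, by omega, .inl ?_⟩
      rw [vvecD_of_lt α β t hi, vvecD_add]
      linarith
    · refine ⟨i, j, hij, by omega, .inr ?_⟩
      rw [vvecD_of_lt α β t (hij.trans hj), vvecD_of_lt α β t hj]
      linarith
end

section
/- With the notation of the context, the set S_D(α,β) is unchanged if β_l is replaced by −β_l. Moreover, if β_l = 0 then S_D(α,β) has strictly fewer than d = 2kl + k(k−1)/2 elements; in particular S_D(α,β) ≠ {1, 2, …, d}. -/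
/-- The set of integers
`S_D(α,β) = {αᵢ + βⱼ} ∪ {αᵢ - βⱼ} ∪ {(αᵢ + αⱼ)/2 : i < j, (αᵢ + αⱼ)/2 ∈ ℤ}`,
with 0-based indices `i < k`, `j < l`. -/
def SD (k l : ℕ) (α β : ℕ → ℚ) : Set ℤ :=
  {t | (∃ i < k, ∃ j < l, (t : ℚ) = α i + β j) ∨
       (∃ i < k, ∃ j < l, (t : ℚ) = α i - β j) ∨
       (∃ i j, i < j ∧ j < k ∧ 2 * (t : ℚ) = α i + α j)}

theorem SD_subset_update_neg (k l m : ℕ) (α β : ℕ → ℚ) :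
    SD k l α β ⊆ SD k l α (Function.update β m (-β m)) := by
  rintro t (⟨i, hi, j, hj, h⟩ | ⟨i, hi, j, hj, h⟩ | h)
  · by_cases hjm : j = m
    · exact Or.inr (Or.inl ⟨i, hi, j, hj, by simp [hjm, h]⟩)
    · exact Or.inl ⟨i, hi, j, hj, by simp [hjm, h]⟩
  · by_cases hjm : j = m
    · exact Or.inl ⟨i, hi, j, hj, by simp [hjm, h, sub_eq_add_neg]⟩
    · exact Or.inr (Or.inl ⟨i, hi, j, hj, by simp [hjm, h]⟩)
  · exact Or.inr (Or.inr h)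

theorem SD_update_neg (k l m : ℕ) (α β : ℕ → ℚ) :
    SD k l α (Function.update β m (-β m)) = SD k l α β := by
  refine Set.Subset.antisymm ?_ (SD_subset_update_neg k l m α β)
  simpa using SD_subset_update_neg k l m α (Function.update β m (-β m))

/-- If the last entry of `β` vanishes, the sums and differences involving it coincide, so that
`S_D(α,β)` lies in a finite set with at most `kl + k(l-1) + k(k-1)/2` elements. -/
theorem exists_finset_SD_subset (k l : ℕ) (hl : 1 ≤ l) (α β : ℕ → ℚ) (h0 : β (l - 1) = 0) :
    ∃ F : Finset ℤ, SD k l α β ⊆ F ∧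
      F.card ≤ k * l + k * (l - 1) + k * (k - 1) / 2 := by
  classical
  let sums := (Finset.range k ×ˢ Finset.range l).image fun p => ⌊α p.1 + β p.2⌋
  let diffs := (Finset.range k ×ˢ Finset.range (l - 1)).image fun p => ⌊α p.1 - β p.2⌋
  let means := ((Finset.range k).sigma fun j => Finset.range j).image
    fun p => ⌊(α p.2 + α p.1) / 2⌋
  refine ⟨sums ∪ diffs ∪ means, ?_, ?_⟩
  · rintro t ht
    simp only [Finset.coe_union, Set.mem_union, Finset.mem_coe]
    rcases ht with ⟨i, hi, j, hj, h⟩ | ⟨i, hi, j, hj, h⟩ | ⟨i, j, hij, hj, h⟩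
    · refine Or.inl (Or.inl (Finset.mem_image.2 ⟨(i, j), by simp [hi, hj], ?_⟩))
      simp [← h]
    · by_cases hjl : j = l - 1
      · refine Or.inl (Or.inl (Finset.mem_image.2 ⟨(i, j), by simp [hi, hj], ?_⟩))
        have h' : (t : ℚ) = α i + β j := by rw [h, hjl, h0]; simp
        simp [← h']
      · refine Or.inl (Or.inr (Finset.mem_image.2
          ⟨(i, j), by simp only [Finset.mem_product, Finset.mem_range]; omega, ?_⟩))
        simp [← h]
    · refine Or.inr (Finset.mem_image.2 ⟨⟨j, i⟩, by simp [hij, hj], ?_⟩)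
      simp [← h]
  · have hsums : sums.card ≤ k * l := Finset.card_image_le.trans (by simp)
    have hdiffs : diffs.card ≤ k * (l - 1) := Finset.card_image_le.trans (by simp)
    have hmeans : means.card ≤ k * (k - 1) / 2 :=
      Finset.card_image_le.trans (by simp [Finset.card_sigma, Finset.sum_range_id])
    have h₁ := Finset.card_union_le (sums ∪ diffs) means
    have h₂ := Finset.card_union_le sums diffs
    omega

/-- `S_D(α,β)` is unchanged if `β_l` is replaced by `-β_l`; moreover, if
`β_l = 0`, then `S_D(α,β)` has strictly fewer than `d = 2kl + k(k-1)/2`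
elements, and in particular `S_D(α,β) ≠ {1, …, d}`. -/
theorem stmt10 (k l : ℕ) (hk : 1 ≤ k) (hl : 1 ≤ l) (α β : ℕ → ℚ)
    (hα : ∀ i j, i < j → j < k → α j < α i)
    (hβ : ∀ i j, i < j → j + 1 < l → β j < β i)
    (hβl : 2 ≤ l → |β (l - 1)| < β (l - 2))
    (hint : ((∀ i < k, ∃ m : ℤ, α i = m) ∧ ∀ j < l, ∃ m : ℤ, β j = m) ∨
            ((∀ i < k, ∃ m : ℤ, α i = m + 1 / 2) ∧
              ∀ j < l, ∃ m : ℤ, β j = m + 1 / 2)) :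
    SD k l α (Function.update β (l - 1) (-β (l - 1))) = SD k l α β ∧
    (β (l - 1) = 0 →
      (SD k l α β).Finite ∧
      (SD k l α β).ncard < 2 * k * l + k * (k - 1) / 2 ∧
      SD k l α β ≠ Set.Icc (1 : ℤ) ((2 * k * l + k * (k - 1) / 2 : ℕ) : ℤ)) := by
  refine ⟨SD_update_neg k l (l - 1) α β, fun h0 => ?_⟩
  obtain ⟨F, hF, hcard⟩ := exists_finset_SD_subset k l hl α β h0
  have hlt : (SD k l α β).ncard < 2 * k * l + k * (k - 1) / 2 := by
    have hle := Set.ncard_le_ncard hF F.finite_toSet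
    rw [Set.ncard_coe_finset] at hle
    obtain ⟨m, rfl⟩ : ∃ m, l = m + 1 := ⟨l - 1, by omega⟩
    have hkl : k * (m + 1) + k * m + k = 2 * k * (m + 1) := by ring
    simp only [Nat.add_sub_cancel] at hcard
    omega
  refine ⟨F.finite_toSet.subset hF, hlt, fun h => hlt.ne ?_⟩
  rw [h, ← Finset.coe_Icc, Set.ncard_coe_finset, Int.card_Icc]
  omega
end

section
/- With the notation of the context, assume k ≥ 4 and l ≥ 2. Then S_D(α,β) ≠ {1, 2, …, d}. Equivalently, there are no irreducible equivariant Ulrich bundles on the even orthogonal Grassmannian OGr(k, 2n) for 3 < k ≤ n − 2. -/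
open Finset in
/-- Double sums of powers of sums expand into products of power sums. -/
theorem sum_sum_add_pow {ι κ : Type*} (s : Finset ι) (t : Finset κ) (x : ι → ℚ) (y : κ → ℚ)
    (m : ℕ) :
    ∑ i ∈ s, ∑ j ∈ t, (x i + y j) ^ m =
      ∑ r ∈ range (m + 1), (∑ i ∈ s, x i ^ r) * (∑ j ∈ t, y j ^ (m - r)) * (m.choose r : ℚ) := by
  simp_rw [add_pow, sum_mul_sum, sum_mul]
  rw [sum_congr rfl fun i _ => sum_comm, sum_comm]

open Finset in
/-- A symmetric double sum over `range k` splits into the part below the diagonal, counted twice,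
and the diagonal. -/
theorem sum_range_sum_range_of_symm (F : ℕ → ℕ → ℚ) (hF : ∀ i j, F i j = F j i) (k : ℕ) :
    ∑ i ∈ range k, ∑ j ∈ range k, F i j =
      2 * ∑ j ∈ range k, ∑ i ∈ range j, F i j + ∑ i ∈ range k, F i i := by
  induction k with
  | zero => simp
  | succ k ih =>
    simp only [sum_range_succ, sum_add_distrib, ih]
    simp_rw [hF k]
    ring

open Finset in
/-- If all odd power sums of `x` vanish, the values of `x` are symmetric about `0`. -/
theorem exists_eq_neg_of_odd_power_sums_eq_zero {ι : Type*} [DecidableEq ι] (s : Finset ι)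
    (x : ι → ℚ) (hx : Set.InjOn x s) (h : ∀ m, Odd m → ∑ i ∈ s, x i ^ m = 0) {i : ι} (hi : i ∈ s)
    (hi0 : x i ≠ 0) : ∃ j ∈ s, x j = -x i := by
  by_contra! hne
  set q : Polynomial ℚ := ∏ j ∈ s.erase i, (Polynomial.X - Polynomial.C (x j ^ 2)) with hq
  have hzero : ∑ j ∈ s, x j * q.eval (x j ^ 2) = 0 := by
    simp_rw [Polynomial.eval_eq_sum_range, mul_sum]
    rw [sum_comm]
    refine sum_eq_zero fun n _ => ?_
    have hn := h (2 * n + 1) ⟨n, rfl⟩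
    rw [← mul_zero (q.coeff n), ← hn, mul_sum]
    refine sum_congr rfl fun j _ => ?_
    ring
  have hsingle : ∑ j ∈ s, x j * q.eval (x j ^ 2) = x i * q.eval (x i ^ 2) := by
    refine sum_eq_single_of_mem i hi fun j hj hji => ?_
    rw [hq, Polynomial.eval_prod, prod_eq_zero (mem_erase.2 ⟨hji, hj⟩) (by simp), mul_zero]
  rw [hsingle, hq, Polynomial.eval_prod] at hzero
  rcases mul_eq_zero.1 hzero with h0 | h0
  · exact hi0 h0
  · obtain ⟨j, hj, hj0⟩ := prod_eq_zero_iff.1 h0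
    obtain ⟨hji, hjs⟩ := mem_erase.1 hj
    simp only [Polynomial.eval_sub, Polynomial.eval_X, Polynomial.eval_C, sub_eq_zero] at hj0
    rcases sq_eq_sq_iff_eq_or_eq_neg.1 hj0 with h1 | h1
    · exact hji (hx hjs hi h1.symm)
    · exact hne j hjs (by rw [h1, neg_neg])

open Finset in
/-- If the odd moments of the centred multiset of all `x i ± y j` and all midpoints of the `x i`
vanish, then so do the odd power sums of `x`. -/
theorem odd_power_sum_eq_zero (k l : ℕ) (hl : 1 ≤ l) (x y : ℕ → ℚ)
    (h : ∀ m, Odd m →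
      ∑ i ∈ range k, ∑ j ∈ range l, (x i + y j) ^ m +
        (∑ i ∈ range k, ∑ j ∈ range l, (x i - y j) ^ m +
          ∑ j ∈ range k, ∑ i ∈ range j, ((x i + x j) / 2) ^ m) = 0)
    (m : ℕ) (hm : Odd m) : ∑ i ∈ range k, x i ^ m = 0 := by
  induction m using Nat.strong_induction_on with
  | _ m ih =>
  have hm0 : m ≠ 0 := by rintro rfl; simp at hm
  have key := h m hm
  have hpm : ∑ i ∈ range k, ∑ j ∈ range l, (x i + y j) ^ m +
      ∑ i ∈ range k, ∑ j ∈ range l, (x i - y j) ^ m = 2 * l * ∑ i ∈ range k, x i ^ m := by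
    simp_rw [sub_eq_add_neg]
    rw [sum_sum_add_pow, sum_sum_add_pow _ _ x (fun j => -y j), ← sum_add_distrib,
      sum_range_succ, sum_eq_zero]
    · simp; ring
    · intro r hr
      have hr := mem_range.1 hr
      rcases Nat.even_or_odd r with he | ho
      · have : Odd (m - r) := Nat.Odd.sub_even hr.le hm he
        simp [this.neg_pow]
      · simp [ih r hr ho]
  have hxx : ∑ i ∈ range k, ∑ j ∈ range k, (x i + x j) ^ m =
      2 * k * ∑ i ∈ range k, x i ^ m := by
    rw [sum_sum_add_pow, sum_range_succ, sum_range_eq_add_Ico _ (Nat.pos_of_ne_zero hm0),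
      sum_eq_zero (s := Ico 1 m)]
    · simp; ring
    · intro r hr
      have hr := mem_Ico.1 hr
      rcases Nat.even_or_odd r with he | ho
      · have : Odd (m - r) := Nat.Odd.sub_even hr.2.le hm he
        simp [ih (m - r) (by omega) this]
      · simp [ih r hr.2 ho]
  rw [sum_range_sum_range_of_symm _ (fun i j => by rw [add_comm])] at hxx
  have hdiag : ∑ i ∈ range k, (x i + x i) ^ m = 2 ^ m * ∑ i ∈ range k, x i ^ m := by
    rw [mul_sum]
    exact sum_congr rfl fun i _ => by rw [← two_mul, mul_pow]
  have hmid : 2 ^ m * ∑ j ∈ range k, ∑ i ∈ range j, ((x i + x j) / 2) ^ m =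
      ∑ j ∈ range k, ∑ i ∈ range j, (x i + x j) ^ m := by
    simp_rw [mul_sum]
    refine sum_congr rfl fun j _ => sum_congr rfl fun i _ => ?_
    rw [← mul_pow]
    congr 1
    ring
  rw [hdiag] at hxx
  rw [← add_assoc, hpm] at key
  have hfac : (2 ^ m * (4 * l - 1) + 2 * k : ℚ) * ∑ i ∈ range k, x i ^ m = 0 := by
    linear_combination 2 * 2 ^ m * key - 2 * hmid - hxx
  have hl' : (1 : ℚ) ≤ l := by exact_mod_cast hl
  have hpos : (0 : ℚ) < 2 ^ m * (4 * l - 1) + 2 * k := by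
    have : (0 : ℚ) < 4 * l - 1 := by linarith
    positivity
  exact (mul_eq_zero.1 hfac).resolve_left hpos.ne'

open Finset in
/-- Odd powers of the centred integers `1, …, d` sum to zero. -/
theorem sum_range_centred_odd_pow (d m : ℕ) (hm : Odd m) :
    ∑ n ∈ range d, ((n : ℚ) + 1 - (d + 1) / 2) ^ m = 0 := by
  have h := sum_range_reflect (fun n : ℕ => ((n : ℚ) + 1 - (d + 1) / 2) ^ m) d
  have h' : ∑ n ∈ range d, (((d - 1 - n : ℕ) : ℚ) + 1 - (d + 1) / 2) ^ m =
      -∑ n ∈ range d, ((n : ℚ) + 1 - (d + 1) / 2) ^ m := by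
    rw [← sum_neg_distrib]
    refine sum_congr rfl fun n hn => ?_
    have hn := mem_range.1 hn
    rw [← hm.neg_pow]
    congr 1
    have : d - 1 - n + (n + 1) = d := by omega
    have : ((d - 1 - n : ℕ) : ℚ) + (n + 1) = d := by exact_mod_cast this
    linarith
  linarith

/-- For `k ≥ 4` and `l ≥ 2` one never has `S_D(α,β) = {1, …, d}` with
`d = 2kl + k(k-1)/2`: there are no irreducible equivariant Ulrich bundles on
`OGr(k, 2n)` for `3 < k ≤ n - 2`. -/
theorem stmt11 (k l : ℕ) (hk : 4 ≤ k) (hl : 2 ≤ l) (α β : ℕ → ℚ)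
    (hα : ∀ i j, i < j → j < k → α j < α i)
    (hβ : ∀ i j, i < j → j + 1 < l → β j < β i)
    (hβl : |β (l - 1)| < β (l - 2))
    (hint : ((∀ i < k, ∃ m : ℤ, α i = m) ∧ ∀ j < l, ∃ m : ℤ, β j = m) ∨
            ((∀ i < k, ∃ m : ℤ, α i = m + 1 / 2) ∧
              ∀ j < l, ∃ m : ℤ, β j = m + 1 / 2)) :
    SD k l α β ≠ Set.Icc (1 : ℤ) ((2 * k * l + k * (k - 1) / 2 : ℕ) : ℤ) := by
  classical
  intro hS
  set d : ℕ := 2 * k * l + k * (k - 1) / 2 with hd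
  let R := Finset.range k ×ˢ Finset.range l
  let M := (Finset.range k).sigma fun j => Finset.range j
  let I := R.disjSum (R.disjSum M)
  let f : (ℕ × ℕ) ⊕ ((ℕ × ℕ) ⊕ (Σ _ : ℕ, ℕ)) → ℚ :=
    Sum.elim (fun p => α p.1 + β p.2)
      (Sum.elim (fun p => α p.1 - β p.2) (fun p => (α p.2 + α p.1) / 2))
  let T := (Finset.range d).image fun n : ℕ => (n : ℚ) + 1
  have hinjT : Function.Injective fun n : ℕ => (n : ℚ) + 1 := fun a b hab => by simpa using hab
  have hcT : T.card = d := by rw [Finset.card_image_of_injective _ hinjT, Finset.card_range]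
  have hcI : I.card = d := by
    simp only [I, R, M, Finset.card_disjSum, Finset.card_product, Finset.card_sigma,
      Finset.card_range, Finset.sum_range_id, hd]
    ring
  have hsub : T ⊆ I.image f := by
    intro t ht
    obtain ⟨n, hn, rfl⟩ := Finset.mem_image.1 ht
    have hn := Finset.mem_range.1 hn
    have hmem : ((n : ℤ) + 1) ∈ SD k l α β := by
      rw [hS]
      constructor <;> omega
    rw [Finset.mem_image]
    rcases hmem with ⟨i, hi, j, hj, h⟩ | ⟨i, hi, j, hj, h⟩ | ⟨i, j, hij, hj, h⟩
    · exact ⟨Sum.inl (i, j), by simp [I, R, hi, hj], by simpa [f] using h.symm⟩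
    · exact ⟨Sum.inr (Sum.inl (i, j)), by simp [I, R, hi, hj], by simpa [f] using h.symm⟩
    · refine ⟨Sum.inr (Sum.inr ⟨j, i⟩), by simp [I, M, hij, hj], ?_⟩
      push_cast at h
      simp only [f, Sum.elim_inr]
      linarith
  have hle : (I.image f).card ≤ T.card := by
    rw [hcT, ← hcI]
    exact Finset.card_image_le
  have himg : T = I.image f := Finset.eq_of_subset_of_card_le hsub hle
  have hinj : Set.InjOn f I := Finset.card_image_iff.1 (by rw [← himg, hcT, hcI])
  set c : ℚ := ((d : ℚ) + 1) / 2 with hc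
  have hmom : ∀ m, Odd m →
      ∑ i ∈ Finset.range k, ∑ j ∈ Finset.range l, (α i - c + β j) ^ m +
        (∑ i ∈ Finset.range k, ∑ j ∈ Finset.range l, (α i - c - β j) ^ m +
          ∑ j ∈ Finset.range k, ∑ i ∈ Finset.range j, ((α i - c + (α j - c)) / 2) ^ m) = 0 := by
    intro m hm
    have h1 : ∑ p ∈ I, (f p - c) ^ m = 0 := by
      rw [← Finset.sum_image (f := fun t => (t - c) ^ m) hinj, ← himg,
        Finset.sum_image hinjT.injOn]
      exact sum_range_centred_odd_pow d m hm
    rw [Finset.sum_disjSum, Finset.sum_disjSum, Finset.sum_product, Finset.sum_product,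
      Finset.sum_sigma] at h1
    simp only [f, Sum.elim_inl, Sum.elim_inr] at h1
    rw [← h1]
    congr 1
    · exact Finset.sum_congr rfl fun i _ => Finset.sum_congr rfl fun j _ => by ring
    congr 1
    · exact Finset.sum_congr rfl fun i _ => Finset.sum_congr rfl fun j _ => by ring
    · exact Finset.sum_congr rfl fun i _ => Finset.sum_congr rfl fun j _ => by ring
  have hαinj : Set.InjOn (fun i => α i - c) (Finset.range k) := by
    intro i hi j hj hij
    simp only [Finset.coe_range, Set.mem_Iio, sub_left_inj] at hi hj hij
    rcases lt_trichotomy i j with h | h | h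
    · exact absurd hij (hα i j h hj).ne'
    · exact h
    · exact absurd hij (hα j i h hi).ne
  have hsymm : ∀ i < k, α i ≠ c → ∃ j < k, α j + α i = 2 * c := by
    intro i hi hne
    obtain ⟨j, hj, h⟩ := exists_eq_neg_of_odd_power_sums_eq_zero (Finset.range k) _ hαinj
      (odd_power_sum_eq_zero k l (by omega) _ β hmom) (Finset.mem_range.2 hi) (sub_ne_zero.2 hne)
    exact ⟨j, Finset.mem_range.1 hj, by linarith⟩
  have huniq : ∀ i j i' j', i < j → j < k → i' < j' → j' < k → α i + α j = 2 * c →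
      α i' + α j' = 2 * c → i = i' ∧ j = j' := by
    intro i j i' j' hij hj hij' hj' h h'
    have := @hinj (Sum.inr (Sum.inr ⟨j, i⟩)) (by simp [I, M, hij, hj])
      (Sum.inr (Sum.inr ⟨j', i'⟩)) (by simp [I, M, hij', hj'])
      (by simp only [f, Sum.elim_inr]; rw [h, h'])
    simp only [Sum.inr.injEq, Sigma.mk.injEq, heq_eq_eq] at this
    exact ⟨this.2, this.1⟩
  have h01 := hα 0 1 (by omega) (by omega)
  have h12 := hα 1 2 (by omega) (by omega)
  have h23 := hα 2 3 (by omega) (by omega)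
  rcases lt_or_ge c (α 1) with h1 | h1
  · obtain ⟨i, hi, hi'⟩ := hsymm 0 (by omega) (by linarith)
    obtain ⟨j, hj, hj'⟩ := hsymm 1 (by omega) (by linarith)
    have hi0 : 0 < i := by
      rcases Nat.eq_zero_or_pos i with rfl | h
      · linarith
      · exact h
    have hj1 : 1 < j := by
      by_contra! hle
      interval_cases j <;> linarith
    have := huniq 0 i 1 j hi0 hi hj1 hj (by linarith) (by linarith)
    omega
  · obtain ⟨i, hi, hi'⟩ := hsymm 2 (by omega) (by linarith)
    obtain ⟨j, hj, hj'⟩ := hsymm 3 (by omega) (by linarith)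
    have hlt : ∀ n < k, c < α n → n < 2 := by
      intro n hn h
      by_contra! hle
      rcases hle.eq_or_lt with rfl | h2
      · linarith
      · linarith [hα 2 n h2 hn]
    have hi2 := hlt i hi (by linarith)
    have hj2 := hlt j hj (by linarith)
    have := huniq i 2 j 3 hi2 (by omega) (by omega) (by omega) (by linarith) (by linarith)
    omega
end

section
/- Let n ≥ 3, let α ∈ ℚ and β₁ > β₂ > … > β_{n−2} > |β_{n−1}| be rationals, with α and all β_j lying in ℤ or all lying in ½ + ℤ. Define S = {α + β_j : 1 ≤ j ≤ n−1} ∪ {α − β_j : 1 ≤ j ≤ n−1} ⊆ ℤ. Then S = {1, 2, …, 2n−2} if and only if α = n − ½, β_j = n − j − ½ for 1 ≤ j ≤ n−2, and β_{n−1} = ½ or β_{n−1} = −½. (Equivalently: up to isomorphism, the only irreducible equivariant Ulrich bundles on the even-dimensional quadric Q^{2n−2} are the two spinor bundles S^±, corresponding to the weights λ^± = (½, ½, …, ½, ±½).) -/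
/-- Rationals in the same coset `c + ℤ` satisfying `x < y` differ by at least one. -/
theorem add_one_le_of_lt_of_coset {x y c : ℚ} (hx : ∃ m : ℤ, x = m + c)
    (hy : ∃ m : ℤ, y = m + c) (h : x < y) : x + 1 ≤ y := by
  obtain ⟨a, rfl⟩ := hx
  obtain ⟨b, rfl⟩ := hy
  have hab : a < b := by exact_mod_cast (add_lt_add_iff_right c).1 h
  have : (a : ℚ) + 1 ≤ b := by exact_mod_cast hab
  linarith

/-- The absolute value of a half-odd-integer is a half-odd-integer. -/
theorem exists_abs_eq_add_half {x : ℚ} (hx : ∃ m : ℤ, x = m + 1 / 2) :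
    ∃ m : ℤ, |x| = m + 1 / 2 := by
  obtain ⟨m, rfl⟩ := hx
  rcases abs_choice ((m : ℚ) + 1 / 2) with h | h
  · exact ⟨m, h⟩
  · exact ⟨-m - 1, by rw [h]; push_cast; ring⟩

/-- The absolute value of a half-odd-integer is at least `1 / 2`. -/
theorem half_le_abs_of_eq_add_half {x : ℚ} (hx : ∃ m : ℤ, x = m + 1 / 2) : 1 / 2 ≤ |x| := by
  obtain ⟨m, hm⟩ := exists_abs_eq_add_half hx
  have h0 := abs_nonneg x
  rw [hm] at h0 ⊢
  have : (-1 : ℚ) < m := by linarith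
  have : (-1 : ℤ) < m := by exact_mod_cast this
  have : (0 : ℚ) ≤ m := by exact_mod_cast (by omega : (0 : ℤ) ≤ m)
  linarith

/-- A sequence dropping by at least one at each of the first `N` steps, and by at most `N` in
total, drops by exactly one at each step. -/
theorem eq_sub_of_add_one_le {N : ℕ} {g : ℕ → ℚ} (hstep : ∀ j < N, g (j + 1) + 1 ≤ g j)
    (hN : g 0 ≤ g N + N) : ∀ j ≤ N, g j = g 0 - j := by
  have hup : ∀ j ≤ N, g j ≤ g 0 - j := by
    intro j
    induction j with
    | zero => simp
    | succ j ih =>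
      intro hj
      have h1 := hstep j hj
      have h2 := ih (by omega)
      push_cast
      linarith
  have hlow : ∀ i ≤ N, g N + i ≤ g (N - i) := by
    intro i
    induction i with
    | zero => simp
    | succ i ih =>
      intro hi
      have h1 := hstep (N - (i + 1)) (by omega)
      have h2 := ih (by omega)
      rw [show N - (i + 1) + 1 = N - i by omega] at h1
      push_cast
      linarith
  intro j hj
  have h1 := hlow (N - j) (by omega)
  rw [Nat.sub_sub_self hj, Nat.cast_sub hj] at h1
  linarith [hup j hj]

/-- The two spinor bundles are the only irreducible equivariant Ulrich
bundles on the even quadric `Q^{2n-2}`: for rationals `α` and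
`β₁ > … > β_{n-2} > |β_{n-1}|` (0-based in Lean), all integers or all
half-odd-integers, the set `S = {α + βⱼ} ∪ {α - βⱼ}` equals `{1, …, 2n-2}`
iff `α = n - 1/2`, `βⱼ = n - j - 1/2` for `1 ≤ j ≤ n-2` (math 1-based `j`),
and `β_{n-1} = ±1/2`. -/
theorem stmt12 (n : ℕ) (hn : 3 ≤ n) (α : ℚ) (β : ℕ → ℚ)
    (hβ : ∀ i j, i < j → j + 1 < n - 1 → β j < β i)
    (hβl : |β (n - 2)| < β (n - 3))
    (hint : ((∃ m : ℤ, α = m) ∧ ∀ j < n - 1, ∃ m : ℤ, β j = m) ∨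
            ((∃ m : ℤ, α = m + 1 / 2) ∧ ∀ j < n - 1, ∃ m : ℤ, β j = m + 1 / 2)) :
    {t : ℤ | ∃ j < n - 1, (t : ℚ) = α + β j ∨ (t : ℚ) = α - β j}
      = Set.Icc (1 : ℤ) (2 * (n : ℤ) - 2) ↔
    α = (n : ℚ) - 1 / 2 ∧ (∀ j < n - 2, β j = (n : ℚ) - (j + 1) - 1 / 2) ∧
      (β (n - 2) = 1 / 2 ∨ β (n - 2) = -(1 / 2)) := by
  obtain ⟨k, rfl⟩ : ∃ k, n = k + 3 := ⟨n - 3, by omega⟩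
  simp only [show k + 3 - 1 = k + 2 by omega, show k + 3 - 2 = k + 1 by omega,
    show k + 3 - 3 = k by omega] at *
  have hle : ∀ i j, i ≤ j → j ≤ k → β j ≤ β i := by
    intro i j hij hj
    rcases hij.eq_or_lt with rfl | h
    · exact le_rfl
    · exact (hβ i j h (by omega)).le
  have hpos : ∀ j ≤ k, 0 < β j := fun j hj =>
    ((abs_nonneg _).trans_lt hβl).trans_le (hle j k hj le_rfl)
  have habs : ∀ j ≤ k, |β j| = β j := fun j hj => abs_of_pos (hpos j hj)
  constructor
  · intro hS
    have hle0 : ∀ j < k + 2, |β j| ≤ β 0 := by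
      intro j hj
      rcases (by omega : j ≤ k ∨ j = k + 1) with h | rfl
      · rw [habs j h]; exact hle 0 j (by omega) h
      · exact hβl.le.trans (hle 0 k (by omega) le_rfl)
    obtain ⟨⟨p, hp⟩, ⟨q, hq⟩⟩ : (∃ p : ℤ, (p : ℚ) = α + β 0) ∧ ∃ q : ℤ, (q : ℚ) = α - β 0 := by
      rcases hint with ⟨⟨a, ha⟩, h⟩ | ⟨⟨a, ha⟩, h⟩ <;> obtain ⟨b, hb⟩ := h 0 (by omega)
      · exact ⟨⟨a + b, by rw [ha, hb]; push_cast; ring⟩, ⟨a - b, by rw [ha, hb]; push_cast; ring⟩⟩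
      · exact ⟨⟨a + b + 1, by rw [ha, hb]; push_cast; ring⟩,
          ⟨a - b, by rw [ha, hb]; push_cast; ring⟩⟩
    have hbound : ∀ t ∈ Set.Icc (1 : ℤ) (2 * ((k + 3 : ℕ) : ℤ) - 2), q ≤ t ∧ t ≤ p := by
      intro t ht
      rw [← hS] at ht
      obtain ⟨j, hj, h⟩ := ht
      have h1 := abs_le.1 (hle0 j hj)
      have : (q : ℚ) ≤ t ∧ (t : ℚ) ≤ p := by
        rcases h with h | h <;> constructor <;> linarith
      exact_mod_cast this
    have hpm : p ∈ Set.Icc (1 : ℤ) (2 * ((k + 3 : ℕ) : ℤ) - 2) := by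
      rw [← hS]; exact ⟨0, by omega, Or.inl hp⟩
    have hqm : q ∈ Set.Icc (1 : ℤ) (2 * ((k + 3 : ℕ) : ℤ) - 2) := by
      rw [← hS]; exact ⟨0, by omega, Or.inr hq⟩
    have hmin := (hbound 1 ⟨le_rfl, by push_cast; omega⟩).1
    have hmax := (hbound (2 * ((k + 3 : ℕ) : ℤ) - 2) ⟨by push_cast; omega, le_rfl⟩).2
    obtain rfl : q = 1 := le_antisymm hmin hqm.1
    obtain rfl : p = 2 * ((k + 3 : ℕ) : ℤ) - 2 := le_antisymm hpm.2 hmax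
    push_cast at hp hq
    have hα : α = k + 5 / 2 := by linarith
    have hβ0 : β 0 = k + 3 / 2 := by linarith
    have hhalf : ∀ j < k + 2, ∃ m : ℤ, β j = m + 1 / 2 := by
      rcases hint with ⟨⟨a, ha⟩, -⟩ | ⟨-, h⟩
      · exfalso
        have : (2 * a : ℚ) = 2 * k + 5 := by linarith
        have : (2 * a : ℤ) = 2 * k + 5 := by exact_mod_cast this
        omega
      · exact h
    have hstep : ∀ j < k + 1, |β (j + 1)| + 1 ≤ |β j| := by
      intro j hj
      refine add_one_le_of_lt_of_coset (exists_abs_eq_add_half (hhalf _ (by omega)))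
        (exists_abs_eq_add_half (hhalf _ (by omega))) ?_
      rw [habs j (by omega)]
      rcases (by omega : j + 1 ≤ k ∨ j = k) with h | rfl
      · rw [habs _ h]; exact hβ _ _ (by omega) (by omega)
      · exact hβl
    have hlast := half_le_abs_of_eq_add_half (hhalf (k + 1) (by omega))
    have habs0 : |β 0| = k + 3 / 2 := by rw [habs 0 (by omega), hβ0]
    have hγ := eq_sub_of_add_one_le (g := fun j => |β j|) hstep (by
      simp only [habs0]; push_cast; linarith)
    simp only [habs0] at hγ
    refine ⟨by rw [hα]; push_cast; ring, fun j hj => ?_, ?_⟩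
    · rw [← habs j (by omega), hγ j (by omega)]; push_cast; ring
    · refine eq_or_eq_neg_of_abs_eq ?_
      rw [hγ (k + 1) le_rfl]; push_cast; ring
  · rintro ⟨hα, hb, hl⟩
    push_cast at hα hb
    ext t
    simp only [Set.mem_ofPred_eq, Set.mem_Icc]
    constructor
    · rintro ⟨j, hj, h⟩
      have hbd : |β j| ≤ k + 3 / 2 := by
        rcases (by omega : j < k + 1 ∨ j = k + 1) with h | rfl
        · rw [habs j (by omega), hb j h]
          have : (0 : ℚ) ≤ j := j.cast_nonneg
          linarith
        · have : (0 : ℚ) ≤ k := k.cast_nonneg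
          rcases hl with h | h <;> rw [h, abs_le] <;> constructor <;> linarith
      have h1 := abs_le.1 hbd
      have : (1 : ℚ) ≤ t ∧ (t : ℚ) ≤ 2 * (k + 3) - 2 := by
        rcases h with h | h <;> constructor <;> linarith
      push_cast
      exact_mod_cast this
    · rintro ⟨h1, h2⟩
      push_cast at h2
      rcases (by omega : t ≤ k + 1 ∨ t = k + 2 ∨ t = k + 3 ∨ k + 4 ≤ t) with h | rfl | rfl | h
      · obtain ⟨j, rfl⟩ : ∃ j : ℕ, t = j + 1 := ⟨(t - 1).toNat, by omega⟩
        refine ⟨j, by omega, Or.inr ?_⟩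
        rw [hα, hb j (by omega)]; push_cast; ring
      · refine ⟨k + 1, by omega, ?_⟩
        rcases hl with h | h
        · right; rw [hα, h]; push_cast; ring
        · left; rw [hα, h]; push_cast; ring
      · refine ⟨k + 1, by omega, ?_⟩
        rcases hl with h | h
        · left; rw [hα, h]; push_cast; ring
        · right; rw [hα, h]; push_cast; ring
      · obtain ⟨j, rfl⟩ : ∃ j : ℕ, t = 2 * k + 4 - j := ⟨(2 * k + 4 - t).toNat, by omega⟩
        refine ⟨j, by omega, Or.inl ?_⟩
        rw [hα, hb j (by omega)]; push_cast; ring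
end

section
/- Let n ≥ 4, k = 3, l = n − 3, and let α₁ > α₂ > α₃ and β₁ > … > β_{l−1} > |β_l| be rationals with all entries of α and β in ℤ or all in ½ + ℤ. Then a pair (α, β) with S_D(α,β) = {1, 2, …, 6n−15} exists if and only if l = n−3 is even, say n − 3 = 2q. In that case S_D(α,β) = {1, 2, …, 6n−15} holds if and only if α = (3n−5, 3n−7, 3n−9) and the sequence (β₁, …, β_{l−1}, |β_l|) satisfies β_{2m+1} = D−2−6m and β_{2m+2} = D−3−6m for all 0 ≤ m ≤ q−1, where D = 3n−8. (This classifies the irreducible equivariant Ulrich bundles on the even orthogonal Grassmannian OGr(3, 2n): they exist exactly when n − 3 is even, and then there are exactly two of them, differing by the sign of the last coordinate of the weight.) -/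
/-- The sequence `(β₁, …, β_{l-1}, |β_l|)` (0-based entry `j`, with `l - 1`
the last index). -/
def absLast (l : ℕ) (β : ℕ → ℚ) (j : ℕ) : ℚ :=
  if j = l - 1 then |β j| else β j

/-- Hypotheses for `OGr(3, 2n)` (here `k = 3`, `l = n - 3`):
`α₁ > α₂ > α₃` and `β₁ > … > β_{l-1} > |β_l|` are rationals, all integers or
all half-odd-integers. -/
def HypD3 (n : ℕ) (α β : ℕ → ℚ) : Prop :=
  (∀ i j, i < j → j < 3 → α j < α i) ∧
  (∀ i j, i < j → j + 1 < n - 3 → β j < β i) ∧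
  (2 ≤ n - 3 → |β (n - 4)| < β (n - 5)) ∧
  (((∀ i < 3, ∃ m : ℤ, α i = m) ∧ ∀ j < n - 3, ∃ m : ℤ, β j = m) ∨
   ((∀ i < 3, ∃ m : ℤ, α i = m + 1 / 2) ∧ ∀ j < n - 3, ∃ m : ℤ, β j = m + 1 / 2))

/-- A `0`-`1` pattern starting with two zeros, in which any three consecutive entries
contain exactly one `1`, has period three. -/
theorem iff_mod_three_eq_two {f : ℕ → Prop} {N : ℕ} (h0 : ¬f 0) (h1 : ¬f 1)
    (hex : ∀ k < N, f k ∨ f (k + 1) ∨ f (k + 2))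
    (hdisj : ∀ k < N, ¬(f k ∧ f (k + 1)) ∧ ¬(f k ∧ f (k + 2)) ∧ ¬(f (k + 1) ∧ f (k + 2))) :
    ∀ k ≤ N + 1, (f k ↔ k % 3 = 2) := by
  intro k
  induction k using Nat.strong_induction_on with
  | _ k ih =>
    intro hk
    match k, ih, hk with
    | 0, _, _ => simpa using h0
    | 1, _, _ => simpa using h1
    | k + 2, ih, hk =>
      have e0 := ih k (by omega) (by omega)
      have e1 := ih (k + 1) (by omega) (by omega)
      have e := hex k (by omega)
      obtain ⟨d1, d2, d3⟩ := hdisj k (by omega)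
      constructor
      · intro h
        have : ¬ f k := fun h' => d2 ⟨h', h⟩
        have : ¬ f (k + 1) := fun h' => d3 ⟨h', h⟩
        simp_all only [false_iff]
        omega
      · intro h
        have n0 : ¬ f k := by rw [e0]; omega
        have n1 : ¬ f (k + 1) := by rw [e1]; omega
        tauto

/-- The translates of `T` by `x0`, `x1`, `x2` together with the three half-sums of the `xᵢ`
tile the interval `[-M, M]`, where `T` is symmetric, nonempty and avoids `0`. -/
structure IsTiling (T : ℤ → Prop) (x0 x1 x2 M : ℤ) : Prop where
  not_zero : ¬T 0
  symm : ∀ s, T s → T (-s)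
  nonempty : ∃ s, T s
  lt01 : x1 < x0
  lt12 : x2 < x1
  cover : ∀ s, -M ≤ s ∧ s ≤ M ↔ T (s - x0) ∨ T (s - x1) ∨ T (s - x2) ∨
    2 * s = x0 + x1 ∨ 2 * s = x0 + x2 ∨ 2 * s = x1 + x2
  even01 : ∃ u, 2 * u = x0 + x1
  even02 : ∃ u, 2 * u = x0 + x2
  even12 : ∃ u, 2 * u = x1 + x2
  disj01 : ∀ s, T (s - x0) → ¬T (s - x1)
  disj02 : ∀ s, T (s - x0) → ¬T (s - x2)
  disj12 : ∀ s, T (s - x1) → ¬T (s - x2)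
  half : ∀ s, 2 * s = x0 + x1 ∨ 2 * s = x0 + x2 ∨ 2 * s = x1 + x2 →
    ¬T (s - x0) ∧ ¬T (s - x1) ∧ ¬T (s - x2)

namespace IsTiling

variable {T : ℤ → Prop} {x0 x1 x2 M y : ℤ}

theorem mem_bounds (h : IsTiling T x0 x1 x2 M) {s : ℤ} (hs : T s) :
    x0 + s ≤ M ∧ -M ≤ x2 + s := by
  have h0 := (h.cover (x0 + s)).2 (Or.inl (by simpa using hs))
  have h2 := (h.cover (x2 + s)).2 (Or.inr (Or.inr (Or.inl (by simpa using hs))))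
  exact ⟨h0.2, h2.1⟩

theorem nonneg (h : IsTiling T x0 x1 x2 M) : 0 ≤ M := by
  obtain ⟨t, ht⟩ := h.nonempty
  have := (h.cover (x0 + t)).2 (Or.inl (by simpa using ht))
  omega

/-- The reflection of a tiling. -/
theorem neg (h : IsTiling T x0 x1 x2 M) : IsTiling T (-x2) (-x1) (-x0) M := by
  have key : ∀ s x, T (s - -x) ↔ T (-s - x) := fun s x =>
    ⟨fun hs => by simpa [sub_eq_add_neg, add_comm] using h.symm _ hs,
      fun hs => by simpa [sub_eq_add_neg, add_comm] using h.symm _ hs⟩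
  refine ⟨h.not_zero, h.symm, h.nonempty, by linarith [h.lt12], by linarith [h.lt01], ?_,
    ?_, ?_, ?_, ?_, ?_, ?_, ?_⟩
  · intro s
    have := h.cover (-s)
    simp only [key]
    constructor
    · intro hs
      rcases this.1 (by omega) with h | h | h | h | h | h
      · tauto
      · tauto
      · tauto
      all_goals omega
    · intro hs
      have := this.2 (by
        rcases hs with h | h | h | h | h | h
        · tauto
        · tauto
        · tauto
        all_goals omega)
      omega
  · obtain ⟨u, hu⟩ := h.even12; exact ⟨-u, by omega⟩
  · obtain ⟨u, hu⟩ := h.even02; exact ⟨-u, by omega⟩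
  · obtain ⟨u, hu⟩ := h.even01; exact ⟨-u, by omega⟩
  · intro s; simp only [key]; exact fun a b => h.disj12 _ b a
  · intro s; simp only [key]; exact fun a b => h.disj02 _ b a
  · intro s; simp only [key]; exact fun a b => h.disj01 _ b a
  · intro s hs
    simp only [key]
    have := h.half (-s) (by omega)
    tauto

theorem top_mem (h : IsTiling T x0 x1 x2 M) : T (M - x0) := by
  obtain ⟨t, ht⟩ := h.nonempty
  have b1 := h.mem_bounds ht
  have b2 := h.mem_bounds (h.symm t ht)
  have l1 := h.lt01
  have l2 := h.lt12
  have hM := h.nonneg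
  rcases (h.cover M).1 ⟨by omega, le_rfl⟩ with h' | h' | h' | h' | h' | h'
  · exact h'
  · have := h.mem_bounds h'; omega
  · have := h.mem_bounds h'; omega
  all_goals omega

theorem add_eq_zero (h : IsTiling T x0 x1 x2 M) : x0 + x2 = 0 := by
  have h1 := h.top_mem
  have h2 := h.neg.top_mem
  have b1 := h.mem_bounds (h.symm _ h1)
  have b2 := h.mem_bounds h2
  omega

theorem middle_nonpos (h : IsTiling T x0 x1 x2 M) : x1 ≤ 0 := by
  by_contra! hx
  have h02 := h.add_eq_zero
  have l1 := h.lt01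
  have l2 := h.lt12
  have htop := h.top_mem
  -- an element of the part formed by `T + x1` and two half-sums, beyond its mirror image
  have key : ∀ e, -M ≤ e → e ≤ M → ¬T (e - x0) → ¬T (e - x2) → x0 + x1 ≤ 2 * e →
      M - x0 + x1 ≤ e → False := by
    intro e he1 he2 n0 n2 hge hge'
    rcases (h.cover (-e)).1 (by omega) with h' | h' | h' | h' | h' | h'
    · apply n2; have := h.symm _ h'; convert this using 1; omega
    · have := h.mem_bounds (h.symm _ h'); omega
    · apply n0; have := h.symm _ h'; convert this using 1; omega
    all_goals omega
  obtain ⟨u, hu⟩ := h.even01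
  by_cases hc : u ≤ M - x0 + x1
  · have hT1 : T (M - x0 + x1 - x1) := by simpa using htop
    have hb := (h.cover (M - x0 + x1)).2 (Or.inr (Or.inl hT1))
    exact key _ hb.1 hb.2 (fun h' => h.disj01 _ h' hT1) (h.disj12 _ hT1) (by omega) le_rfl
  · have hb := (h.cover u).2 (by tauto)
    have hh := h.half u (Or.inl hu)
    exact key u hb.1 hb.2 hh.1 hh.2.2 (by omega) (by omega)

theorem middle_eq_zero (h : IsTiling T x0 x1 x2 M) : x1 = 0 := by
  have := h.middle_nonpos
  have := h.neg.middle_nonpos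
  omega

/-- In a tiling with translates `2y, 0, -2y`, membership in `T` along an arithmetic
progression of step `2y` that starts with two non-members has period three. -/
theorem chain (h : IsTiling T (2 * y) 0 (-(2 * y)) M) {s : ℤ} {N : ℕ} (h0 : ¬T s)
    (h1 : ¬T (s + 2 * y)) (hlow : -M ≤ s + 2 * y) (hupp : s + 2 * y * N ≤ M)
    (hy : ∀ k : ℕ, 1 ≤ k → k ≤ N →
      s + 2 * y * k ≠ 0 ∧ s + 2 * y * k ≠ y ∧ s + 2 * y * k ≠ -y) :
    ∀ k ≤ N + 1, (T (s + 2 * y * (k : ℕ)) ↔ k % 3 = 2) := by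
  have hpos : 0 < y := by have := h.lt01; omega
  apply iff_mod_three_eq_two
  · simpa using h0
  · simpa using h1
  all_goals
    intro k hk
    have e0 : s + 2 * y * ((k + 1 : ℕ) : ℤ) - 2 * y = s + 2 * y * (k : ℕ) := by push_cast; ring
    have e2 : s + 2 * y * ((k + 1 : ℕ) : ℤ) - -(2 * y) = s + 2 * y * ((k + 2 : ℕ) : ℤ) := by
      push_cast; ring
  · obtain ⟨n0, n1, n2⟩ := hy (k + 1) (by omega) (by omega)
    have hle : s + 2 * y * ((k + 1 : ℕ) : ℤ) ≤ M := by
      refine le_trans ?_ hupp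
      have : ((k + 1 : ℕ) : ℤ) ≤ N := by exact_mod_cast hk
      gcongr
    have hge : -M ≤ s + 2 * y * ((k + 1 : ℕ) : ℤ) := by
      push_cast
      have : 0 ≤ y * (k : ℤ) := by positivity
      linarith
    have := (h.cover (s + 2 * y * ((k + 1 : ℕ) : ℤ))).1 ⟨hge, hle⟩
    rw [e0, e2, sub_zero] at this
    rcases this with h' | h' | h' | h' | h' | h'
    · tauto
    · tauto
    · tauto
    · exact absurd (by linarith) n1
    · exact absurd (by linarith) n0
    · exact absurd (by linarith) n2
  · have d1 := h.disj01 (s + 2 * y * ((k + 1 : ℕ) : ℤ))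
    have d2 := h.disj02 (s + 2 * y * ((k + 1 : ℕ) : ℤ))
    have d3 := h.disj12 (s + 2 * y * ((k + 1 : ℕ) : ℤ))
    rw [e0] at d1 d2
    rw [e2] at d2 d3
    rw [sub_zero] at d1 d3
    tauto

/-- If the progression in `chain` exhausts the interval, its length is divisible by three. -/
theorem chain_length (h : IsTiling T (2 * y) 0 (-(2 * y)) M) {s : ℤ} {N : ℕ} (h0 : ¬T s)
    (h1 : ¬T (s + 2 * y)) (hlow : -M ≤ s + 2 * y) (hupp : s + 2 * y * N ≤ M)
    (hlast : M < s + 2 * y * N + 2 * y)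
    (hy : ∀ k : ℕ, 1 ≤ k → k ≤ N →
      s + 2 * y * k ≠ 0 ∧ s + 2 * y * k ≠ y ∧ s + 2 * y * k ≠ -y) :
    N % 3 = 0 := by
  have hpos : 0 < y := by have := h.lt01; omega
  have hc := h.chain h0 h1 hlow hupp hy
  have n1 : N % 3 ≠ 2 := fun hN => by
    have := h.mem_bounds ((hc N (by omega)).2 hN); linarith
  have n2 : (N + 1) % 3 ≠ 2 := fun hN => by
    have := h.mem_bounds ((hc (N + 1) (by omega)).2 hN)
    push_cast at this
    linarith
  omega

theorem not_mem_small (h : IsTiling T (2 * y) 0 (-(2 * y)) M) :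
    ¬T 0 ∧ ¬T (2 * y) ∧ ¬T y ∧ ¬T (3 * y) := by
  have a := h.half 0 (by omega)
  have b := h.half y (by omega)
  refine ⟨h.not_zero, ?_, ?_, ?_⟩
  · simpa using a.2.2
  · simpa using b.2.1
  · have := b.2.2
    rwa [show y - -(2 * y) = 3 * y by ring] at this

theorem ne_of_pos_chain (hpos : 0 < y) (k : ℕ) (hk : 1 ≤ k) :
    (0 + 2 * y * (k : ℤ) ≠ 0 ∧ 0 + 2 * y * (k : ℤ) ≠ y ∧ 0 + 2 * y * (k : ℤ) ≠ -y) ∧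
    (y + 2 * y * (k : ℤ) ≠ 0 ∧ y + 2 * y * (k : ℤ) ≠ y ∧ y + 2 * y * (k : ℤ) ≠ -y) := by
  have : y * 1 ≤ y * (k : ℤ) := by gcongr; exact_mod_cast hk
  refine ⟨⟨?_, ?_, ?_⟩, ?_, ?_, ?_⟩ <;> intro h <;> linarith

theorem half_le (h : IsTiling T (2 * y) 0 (-(2 * y)) M) : y ≤ M :=
  ((h.cover y).2 (by omega)).2

/-- The number of multiples of `2y` in `(0, M]` is divisible by three, and `M` is in the upper
half of its residue interval modulo `2y`. -/
theorem exists_quotient (h : IsTiling T (2 * y) 0 (-(2 * y)) M) :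
    ∃ K : ℕ, K % 3 = 0 ∧ y + 2 * y * K ≤ M ∧ M < 2 * y * K + 2 * y := by
  have hpos : 0 < y := by have := h.lt01; omega
  have hyM := h.half_le
  obtain ⟨n0, n2, n1, n3⟩ := h.not_mem_small
  have aux : ∀ a : ℤ, 0 ≤ a → ∃ K : ℕ, 2 * y * K ≤ a ∧ a < 2 * y * K + 2 * y := by
    intro a ha
    have := Int.emod_nonneg a (show 2 * y ≠ 0 by omega)
    have := Int.emod_lt_of_pos a (show 0 < 2 * y by omega)
    have := Int.mul_ediv_add_emod a (2 * y)
    have hq : 0 ≤ a / (2 * y) := Int.ediv_nonneg ha (by omega)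
    refine ⟨(a / (2 * y)).toNat, ?_, ?_⟩ <;> rw [Int.toNat_of_nonneg hq] <;> linarith
  obtain ⟨K, hK1, hK2⟩ := aux M (by omega)
  obtain ⟨L, hL1, hL2⟩ := aux (M - y) (by omega)
  have hK := h.chain_length (s := 0) (N := K) n0 (by simpa using n2) (by omega) (by linarith)
    (by linarith) (fun k hk _ => (ne_of_pos_chain hpos k hk).1)
  have hL := h.chain_length (s := y) (N := L) n1 (by rwa [show y + 2 * y = 3 * y by ring]) (by omega)
    (by linarith) (by linarith) (fun k hk _ => (ne_of_pos_chain hpos k hk).2)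
  have hLK : L ≤ K := by
    by_contra! hc
    have : 2 * y * ((K + 1 : ℕ) : ℤ) ≤ 2 * y * L := by
      have : ((K + 1 : ℕ) : ℤ) ≤ L := by exact_mod_cast hc
      gcongr
    push_cast at this
    linarith
  have hKL : K ≤ L + 1 := by
    by_contra! hc
    have : 2 * y * ((L + 2 : ℕ) : ℤ) ≤ 2 * y * K := by
      have : ((L + 2 : ℕ) : ℤ) ≤ K := by exact_mod_cast hc
      gcongr
    push_cast at this
    linarith
  obtain rfl : K = L := by omega
  exact ⟨K, hK, by linarith, hK2⟩

theorem step_eq_one (h : IsTiling T (2 * y) 0 (-(2 * y)) M) : y = 1 := by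
  have hpos : 0 < y := by have := h.lt01; omega
  by_contra hne
  obtain ⟨K, hK, hK1, hK2⟩ := h.exists_quotient
  have special : ∀ j : ℤ, 1 + 2 * y * j ≠ 0 ∧ 1 + 2 * y * j ≠ y ∧ 1 + 2 * y * j ≠ -y := by
    intro j
    have hd : ∀ c : ℤ, 1 ≠ y * c := fun c hc =>
      hne (Int.eq_one_of_mul_eq_one_right hpos.le hc.symm)
    refine ⟨fun e => hd (-(2 * j)) (by linarith), fun e => hd (1 - 2 * j) (by linarith),
      fun e => hd (-1 - 2 * j) (by linarith)⟩
  -- the progression `1 + 2y ℤ` in `[-M, M]`, with `L` terms below `1`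
  have key : ∀ L : ℕ, 2 * y * L ≤ M + 1 → M + 1 < 2 * y * L + 2 * y → (L + K + 1) % 3 = 0 := by
    intro L hL1 hL2
    refine h.chain_length (s := 1 + 2 * y * (-(L : ℤ) - 1)) (N := L + K + 1) ?_ ?_ (by linarith)
      (by push_cast; linarith) (by push_cast; linarith) ?_
    · intro ht; have := h.mem_bounds ht; linarith
    · intro ht; have := h.mem_bounds ht; linarith
    · intro k _ _
      have := special (-(L : ℤ) - 1 + k)
      rwa [mul_add, ← add_assoc] at this
  by_cases hc : M + 1 < 2 * y * K + 2 * y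
  · have := key K (by linarith) hc
    omega
  · have := key (K + 1) (by push_cast; linarith) (by push_cast; linarith)
    omega

/-- Classification of the tilings. -/
theorem classification (h : IsTiling T x0 x1 x2 M) :
    x0 = 2 ∧ x1 = 0 ∧ x2 = -2 ∧ ∃ q : ℕ, M = 6 * q + 1 ∧
      ∀ s, 0 ≤ s → (T s ↔ s < 6 * q ∧ (s % 6 = 4 ∨ s % 6 = 5)) := by
  have hx1 := h.middle_eq_zero
  have hx02 := h.add_eq_zero
  obtain ⟨y, hy⟩ := h.even01
  obtain rfl : x0 = 2 * y := by omega
  obtain rfl : x2 = -(2 * y) := by omega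
  subst hx1
  obtain rfl := h.step_eq_one
  obtain ⟨K, hK, hK1, hK2⟩ := h.exists_quotient
  obtain ⟨n0, n2, n1, n3⟩ := h.not_mem_small
  refine ⟨by norm_num, rfl, by norm_num, K / 3, by omega, ?_⟩
  intro s hs
  by_cases hsM : s ≤ M
  · have c0 := h.chain (s := 0) (N := K) n0 (by simpa using n2) (by omega) (by omega)
      (fun k hk _ => (ne_of_pos_chain one_pos k hk).1) (s / 2).toNat (by omega)
    have c1 := h.chain (s := 1) (N := K) n1 (by simpa using n3) (by omega) (by omega)
      (fun k hk _ => (ne_of_pos_chain one_pos k hk).2) (s / 2).toNat (by omega)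
    rcases Int.emod_two_eq_zero_or_one s with he | he
    · rw [show (0 : ℤ) + 2 * 1 * ((s / 2).toNat : ℤ) = s by omega] at c0
      rw [c0]
      omega
    · rw [show (1 : ℤ) + 2 * 1 * ((s / 2).toNat : ℤ) = s by omega] at c1
      rw [c1]
      omega
  · constructor
    · intro ht; have := h.mem_bounds ht; omega
    · omega

end IsTiling

/-- The integers whose absolute value is one of the `|βⱼ|`, `j < l`. -/
def AbsMem (l : ℕ) (β : ℕ → ℚ) (s : ℤ) : Prop :=
  ∃ j < l, |(s : ℚ)| = |β j|

theorem mem_SD_three_iff {l : ℕ} {α β : ℕ → ℚ} {a0 a1 a2 : ℤ} (h0 : α 0 = a0) (h1 : α 1 = a1)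
    (h2 : α 2 = a2) (t : ℤ) :
    t ∈ SD 3 l α β ↔ AbsMem l β (t - a0) ∨ AbsMem l β (t - a1) ∨ AbsMem l β (t - a2) ∨
      2 * t = a0 + a1 ∨ 2 * t = a0 + a2 ∨ 2 * t = a1 + a2 := by
  have hT : ∀ i : ℕ, ∀ a : ℤ, α i = a → (AbsMem l β (t - a) ↔
      (∃ j < l, (t : ℚ) = α i + β j) ∨ ∃ j < l, (t : ℚ) = α i - β j) := by
    intro i a ha
    simp only [AbsMem, abs_eq_abs, ha, Int.cast_sub, ← exists_or, ← and_or_left]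
    refine exists_congr fun j => and_congr_right fun _ => or_congr ?_ ?_ <;>
      constructor <;> intro h <;> linarith
  rw [hT 0 a0 h0, hT 1 a1 h1, hT 2 a2 h2]
  have c01 : 2 * t = a0 + a1 ↔ 2 * (t : ℚ) = α 0 + α 1 := by rw [h0, h1]; norm_cast
  have c02 : 2 * t = a0 + a2 ↔ 2 * (t : ℚ) = α 0 + α 2 := by rw [h0, h2]; norm_cast
  have c12 : 2 * t = a1 + a2 ↔ 2 * (t : ℚ) = α 1 + α 2 := by rw [h1, h2]; norm_cast
  rw [c01, c02, c12]
  simp only [SD, Set.mem_ofPred_eq]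
  constructor
  · rintro (⟨i, hi, h⟩ | ⟨i, hi, h⟩ | ⟨i, j, hij, hj, h⟩)
    · interval_cases i <;> simp only [h, true_or, or_true]
    · interval_cases i <;> simp only [h, true_or, or_true]
    · interval_cases j <;> interval_cases i <;> tauto
  · rintro ((h | h) | (h | h) | (h | h) | h | h | h)
    · exact Or.inl ⟨0, by norm_num, h⟩
    · exact Or.inr (Or.inl ⟨0, by norm_num, h⟩)
    · exact Or.inl ⟨1, by norm_num, h⟩
    · exact Or.inr (Or.inl ⟨1, by norm_num, h⟩)
    · exact Or.inl ⟨2, by norm_num, h⟩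
    · exact Or.inr (Or.inl ⟨2, by norm_num, h⟩)
    · exact Or.inr (Or.inr ⟨0, 1, by norm_num, by norm_num, h⟩)
    · exact Or.inr (Or.inr ⟨0, 2, by norm_num, by norm_num, h⟩)
    · exact Or.inr (Or.inr ⟨1, 2, by norm_num, by norm_num, h⟩)

/-- The `6l + 3` candidate values for the elements of `SD 3 l α β`. -/
def entry (l : ℕ) (α β : ℕ → ℚ) : (Fin 3 × Fin l × Bool) ⊕ Fin 3 → ℚ
  | .inl (i, j, true) => α i + β j
  | .inl (i, j, false) => α i - β j
  | .inr 0 => (α 0 + α 1) / 2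
  | .inr 1 => (α 0 + α 2) / 2
  | .inr 2 => (α 1 + α 2) / 2

theorem exists_entry_eq {l : ℕ} {α β : ℕ → ℚ} {t : ℤ} (ht : t ∈ SD 3 l α β) :
    ∃ x, entry l α β x = t := by
  rcases ht with ⟨i, hi, j, hj, h⟩ | ⟨i, hi, j, hj, h⟩ | ⟨i, j, hij, hj, h⟩
  · exact ⟨.inl (⟨i, hi⟩, ⟨j, hj⟩, true), h.symm⟩
  · exact ⟨.inl (⟨i, hi⟩, ⟨j, hj⟩, false), h.symm⟩
  · have : (i = 0 ∧ j = 1) ∨ (i = 0 ∧ j = 2) ∨ (i = 1 ∧ j = 2) := by omega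
    rcases this with ⟨rfl, rfl⟩ | ⟨rfl, rfl⟩ | ⟨rfl, rfl⟩
    · exact ⟨.inr 0, by simp only [entry]; linarith⟩
    · exact ⟨.inr 1, by simp only [entry]; linarith⟩
    · exact ⟨.inr 2, by simp only [entry]; linarith⟩

/-- By counting, if `SD 3 l α β` is the full interval then all candidate values are distinct
integers. -/
theorem entry_injective_and_integral {l : ℕ} {α β : ℕ → ℚ}
    (h : SD 3 l α β = Set.Icc (1 : ℤ) (6 * l + 3)) :
    Function.Injective (entry l α β) ∧ ∀ x, ∃ t : ℤ, entry l α β x = t := by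
  classical
  set I : Finset ℚ := (Finset.Icc (1 : ℤ) (6 * l + 3)).image (fun t : ℤ => (t : ℚ)) with hI
  have hcardI : I.card = 6 * l + 3 := by
    rw [hI, Finset.card_image_of_injective _ Int.cast_injective, Int.card_Icc]
    omega
  have hsub : I ⊆ Finset.univ.image (entry l α β) := by
    intro x hx
    obtain ⟨t, ht, rfl⟩ := Finset.mem_image.1 hx
    have : t ∈ SD 3 l α β := by rw [h]; simpa using ht
    obtain ⟨x, hx⟩ := exists_entry_eq this
    exact Finset.mem_image.2 ⟨x, Finset.mem_univ _, hx⟩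
  have hcard : (Finset.univ : Finset ((Fin 3 × Fin l × Bool) ⊕ Fin 3)).card = 6 * l + 3 := by
    simp only [Finset.card_univ, Fintype.card_sum, Fintype.card_prod, Fintype.card_fin,
      Fintype.card_bool]
    ring
  have hle : (Finset.univ.image (entry l α β)).card ≤ _ := Finset.card_image_le
  have heq : I = Finset.univ.image (entry l α β) :=
    Finset.eq_of_subset_of_card_le hsub (by omega)
  constructor
  · have := Finset.card_image_iff.1 (show (Finset.univ.image (entry l α β)).card =
      (Finset.univ : Finset ((Fin 3 × Fin l × Bool) ⊕ Fin 3)).card by rw [← heq, hcardI, hcard])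
    exact Set.injOn_univ.1 (by simpa using this)
  · intro x
    have hx : entry l α β x ∈ I := heq ▸ Finset.mem_image_of_mem _ (Finset.mem_univ x)
    obtain ⟨t, _, ht⟩ := Finset.mem_image.1 hx
    exact ⟨t, ht.symm⟩

theorem AbsMem.exists_entry_eq {l : ℕ} {α β : ℕ → ℚ} {t a : ℤ} {i : Fin 3} (ha : α i = a)
    (h : AbsMem l β (t - a)) : ∃ j b, entry l α β (.inl (i, j, b)) = t := by
  obtain ⟨j, hj, h⟩ := h
  rcases abs_eq_abs.1 h with h | h <;> push_cast at h
  · exact ⟨⟨j, hj⟩, true, by simp only [entry]; linarith⟩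
  · exact ⟨⟨j, hj⟩, false, by simp only [entry]; linarith⟩

theorem isTiling_of_SD_eq {l : ℕ} {α β : ℕ → ℚ} (hl : 0 < l)
    (hα : ∀ i j, i < j → j < 3 → α j < α i)
    (hint : ((∀ i < 3, ∃ m : ℤ, α i = m) ∧ ∀ j < l, ∃ m : ℤ, β j = m) ∨
      ((∀ i < 3, ∃ m : ℤ, α i = m + 1 / 2) ∧ ∀ j < l, ∃ m : ℤ, β j = m + 1 / 2))
    (h : SD 3 l α β = Set.Icc (1 : ℤ) (6 * l + 3)) :
    (∀ j < l, ∃ m : ℤ, β j = m) ∧ ∃ a0 a1 a2 : ℤ, α 0 = a0 ∧ α 1 = a1 ∧ α 2 = a2 ∧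
      IsTiling (AbsMem l β) (a0 - (3 * l + 2)) (a1 - (3 * l + 2)) (a2 - (3 * l + 2))
        (3 * l + 1) := by
  obtain ⟨hinj, hZ⟩ := entry_injective_and_integral h
  obtain ⟨u01, hu01⟩ := hZ (.inr 0)
  obtain ⟨u02, hu02⟩ := hZ (.inr 1)
  obtain ⟨u12, hu12⟩ := hZ (.inr 2)
  simp only [entry] at hu01 hu02 hu12
  rcases hint with ⟨hα', hβ⟩ | ⟨hα', _⟩
  swap
  · exfalso
    obtain ⟨m0, h0⟩ := hα' 0 (by norm_num)
    obtain ⟨m1, h1⟩ := hα' 1 (by norm_num)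
    obtain ⟨m2, h2⟩ := hα' 2 (by norm_num)
    have e01 : m0 + m1 + 1 = 2 * u01 := by
      have : (m0 : ℚ) + m1 + 1 = 2 * u01 := by linarith
      exact_mod_cast this
    have e02 : m0 + m2 + 1 = 2 * u02 := by
      have : (m0 : ℚ) + m2 + 1 = 2 * u02 := by linarith
      exact_mod_cast this
    have e12 : m1 + m2 + 1 = 2 * u12 := by
      have : (m1 : ℚ) + m2 + 1 = 2 * u12 := by linarith
      exact_mod_cast this
    omega
  obtain ⟨a0, h0⟩ := hα' 0 (by norm_num)
  obtain ⟨a1, h1⟩ := hα' 1 (by norm_num)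
  obtain ⟨a2, h2⟩ := hα' 2 (by norm_num)
  have l01 : a1 < a0 := by
    have := hα 0 1 (by norm_num) (by norm_num); rw [h0, h1] at this; exact_mod_cast this
  have l12 : a2 < a1 := by
    have := hα 1 2 (by norm_num) (by norm_num); rw [h1, h2] at this; exact_mod_cast this
  have e01 : a0 + a1 = 2 * u01 := by
    have : (a0 : ℚ) + a1 = 2 * u01 := by linarith
    exact_mod_cast this
  have e02 : a0 + a2 = 2 * u02 := by
    have : (a0 : ℚ) + a2 = 2 * u02 := by linarith
    exact_mod_cast this
  have e12 : a1 + a2 = 2 * u12 := by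
    have : (a1 : ℚ) + a2 = 2 * u12 := by linarith
    exact_mod_cast this
  refine ⟨hβ, a0, a1, a2, h0, h1, h2, ?_⟩
  have shift : ∀ s a : ℤ, s - (a - (3 * l + 2)) = s + (3 * l + 2) - a := fun s a => by ring
  have E0 : ∀ {t}, AbsMem l β (t - a0) → _ := fun {t} => AbsMem.exists_entry_eq (i := 0) h0
  have E1 : ∀ {t}, AbsMem l β (t - a1) → _ := fun {t} => AbsMem.exists_entry_eq (i := 1) h1
  have E2 : ∀ {t}, AbsMem l β (t - a2) → _ := fun {t} => AbsMem.exists_entry_eq (i := 2) h2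
  refine ⟨?_, ?_, ?_, by omega, by omega, ?_, ⟨u01 - (3 * l + 2), by linarith⟩,
    ⟨u02 - (3 * l + 2), by linarith⟩, ⟨u12 - (3 * l + 2), by linarith⟩, ?_, ?_, ?_, ?_⟩
  · rintro ⟨j, hj, hz⟩
    have hz : β j = 0 := by simpa using hz.symm
    have := @hinj (.inl (0, ⟨j, hj⟩, true)) (.inl (0, ⟨j, hj⟩, false)) (by simp [entry, hz])
    simp at this
  · rintro s ⟨j, hj, hs⟩
    exact ⟨j, hj, by simpa using hs⟩
  · obtain ⟨b, hb⟩ := hβ 0 hl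
    exact ⟨b, 0, hl, by rw [hb]⟩
  · intro s
    have := mem_SD_three_iff (l := l) (β := β) h0 h1 h2 (s + (3 * l + 2))
    rw [h, Set.mem_Icc] at this
    simp only [shift]
    constructor
    · intro hs
      have := this.1 (by omega)
      refine this.imp_right (Or.imp_right (Or.imp_right ?_))
      omega
    · intro hs
      have := this.2 (hs.imp_right (Or.imp_right (Or.imp_right (by omega))))
      omega
  · intro s
    simp only [shift]
    intro ha hb
    obtain ⟨j, b, hx⟩ := E0 ha
    obtain ⟨j', b', hx'⟩ := E1 hb
    have := hinj (hx.trans hx'.symm)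
    simp at this
  · intro s
    simp only [shift]
    intro ha hb
    obtain ⟨j, b, hx⟩ := E0 ha
    obtain ⟨j', b', hx'⟩ := E2 hb
    have := hinj (hx.trans hx'.symm)
    simp at this
  · intro s
    simp only [shift]
    intro ha hb
    obtain ⟨j, b, hx⟩ := E1 ha
    obtain ⟨j', b', hx'⟩ := E2 hb
    have := hinj (hx.trans hx'.symm)
    simp at this
  · intro s hs
    simp only [shift]
    have hx : ∃ i, entry l α β (.inr i) = ((s + (3 * l + 2) : ℤ) : ℚ) := by
      rcases hs with hs | hs | hs
      · exact ⟨0, by simp only [entry, hu01]; norm_cast; omega⟩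
      · exact ⟨1, by simp only [entry, hu02]; norm_cast; omega⟩
      · exact ⟨2, by simp only [entry, hu12]; norm_cast; omega⟩
    obtain ⟨i, hx⟩ := hx
    refine ⟨fun ha => ?_, fun ha => ?_, fun ha => ?_⟩
    · obtain ⟨j, b, hx'⟩ := E0 ha
      have := hinj (hx.trans hx'.symm)
      simp at this
    · obtain ⟨j, b, hx'⟩ := E1 ha
      have := hinj (hx.trans hx'.symm)
      simp at this
    · obtain ⟨j, b, hx'⟩ := E2 ha
      have := hinj (hx.trans hx'.symm)
      simp at this

theorem abs_absLast (l : ℕ) (β : ℕ → ℚ) (j : ℕ) : |absLast l β j| = |β j| := by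
  unfold absLast
  split_ifs <;> simp

theorem absLast_strictAnti {l : ℕ} {β : ℕ → ℚ} (h1 : ∀ i j, i < j → j + 1 < l → β j < β i)
    (h2 : 2 ≤ l → |β (l - 1)| < β (l - 2)) {i j : ℕ} (hij : i < j) (hj : j < l) :
    absLast l β j < absLast l β i := by
  unfold absLast
  rw [if_neg (show i ≠ l - 1 by omega)]
  split_ifs with hjl
  · subst hjl
    have h2 := h2 (by omega)
    rcases (show i ≤ l - 2 by omega).eq_or_lt with rfl | hi
    · exact h2
    · exact h2.trans (h1 i (l - 2) hi (by omega))
  · exact h1 i j hij (by omega)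

theorem absLast_eq_abs {l : ℕ} {β : ℕ → ℚ} (h1 : ∀ i j, i < j → j + 1 < l → β j < β i)
    (h2 : 2 ≤ l → |β (l - 1)| < β (l - 2)) {j : ℕ} (hj : j < l) :
    absLast l β j = |β j| := by
  rw [← abs_absLast l, eq_comm, abs_eq_self]
  have hlast : 0 ≤ absLast l β (l - 1) := by simp [absLast]
  rcases (show j ≤ l - 1 by omega).eq_or_lt with rfl | hi
  · exact hlast
  · exact hlast.trans (absLast_strictAnti h1 h2 hi (by omega)).le

/-- The decreasing sequence `6q - 1, 6q - 2, 6q - 7, 6q - 8, …`. -/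
def ulrichSeq (q j : ℕ) : ℤ :=
  6 * q - 1 - 6 * (j / 2 : ℕ) - (j % 2 : ℕ)

theorem ulrichSeq_strictAnti (q : ℕ) : StrictAnti (ulrichSeq q) := by
  intro i j hij
  unfold ulrichSeq
  omega

theorem exists_ulrichSeq_eq_iff {q : ℕ} {s : ℤ} (hs : 0 ≤ s) :
    (∃ j < 2 * q, s = ulrichSeq q j) ↔ s < 6 * q ∧ (s % 6 = 4 ∨ s % 6 = 5) := by
  unfold ulrichSeq
  constructor
  · rintro ⟨j, hj, rfl⟩
    omega
  · rintro ⟨hlt, h | h⟩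
    · exact ⟨(2 * (q - 1 - s / 6) + 1).toNat, by omega, by omega⟩
    · exact ⟨(2 * (q - 1 - s / 6)).toNat, by omega, by omega⟩

theorem forall_ulrichSeq_iff {q : ℕ} {f : ℕ → ℚ} :
    (∀ j < 2 * q, f j = ulrichSeq q j) ↔
      ∀ m < q, f (2 * m) = 6 * q - 1 - 6 * m ∧ f (2 * m + 1) = 6 * q - 2 - 6 * m := by
  have even : ∀ m, ulrichSeq q (2 * m) = 6 * q - 1 - 6 * m := fun m => by
    unfold ulrichSeq; omega
  have odd : ∀ m, ulrichSeq q (2 * m + 1) = 6 * q - 2 - 6 * m := fun m => by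
    unfold ulrichSeq; omega
  constructor
  · intro h m hm
    rw [h _ (by omega), h _ (by omega), even, odd]
    push_cast
    exact ⟨rfl, rfl⟩
  · intro h j hj
    rcases Nat.even_or_odd' j with ⟨m, rfl | rfl⟩
    · rw [(h m (by omega)).1, even]; push_cast; rfl
    · rw [(h m (by omega)).2, odd]; push_cast; rfl

theorem SD_eq_Icc_iff {l : ℕ} {α β : ℕ → ℚ} (hl : 0 < l)
    (hα : ∀ i j, i < j → j < 3 → α j < α i)
    (h1 : ∀ i j, i < j → j + 1 < l → β j < β i)
    (h2 : 2 ≤ l → |β (l - 1)| < β (l - 2))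
    (hint : ((∀ i < 3, ∃ m : ℤ, α i = m) ∧ ∀ j < l, ∃ m : ℤ, β j = m) ∨
      ((∀ i < 3, ∃ m : ℤ, α i = m + 1 / 2) ∧ ∀ j < l, ∃ m : ℤ, β j = m + 1 / 2)) :
    SD 3 l α β = Set.Icc (1 : ℤ) (6 * l + 3) ↔
      ∃ q : ℕ, l = 2 * q ∧ α 0 = 3 * l + 4 ∧ α 1 = 3 * l + 2 ∧ α 2 = 3 * l ∧
        ∀ j < 2 * q, absLast l β j = ulrichSeq q j := by
  constructor
  · intro h
    obtain ⟨hβ, a0, a1, a2, h0', h1', h2', ht⟩ := isTiling_of_SD_eq hl hα hint h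
    obtain ⟨x0, x1, x2, q, hq, hT⟩ := ht.classification
    obtain rfl : l = 2 * q := by omega
    obtain rfl : a0 = 3 * (2 * q : ℕ) + 4 := by omega
    obtain rfl : a1 = 3 * (2 * q : ℕ) + 2 := by omega
    obtain rfl : a2 = 3 * (2 * q : ℕ) := by omega
    refine ⟨q, rfl, by rw [h0']; push_cast; rfl, by rw [h1']; push_cast; rfl,
      by rw [h2']; push_cast; rfl, ?_⟩
    have hv : StrictAnti fun j : Fin (2 * q) => absLast (2 * q) β j :=
      fun i j hij => absLast_strictAnti h1 h2 hij j.2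
    have hw : StrictAnti fun j : Fin (2 * q) => (ulrichSeq q j : ℚ) :=
      fun i j hij => Int.cast_lt.2 (ulrichSeq_strictAnti q hij)
    have hrange : (fun j : Fin (2 * q) => absLast (2 * q) β j) =
        fun j : Fin (2 * q) => (ulrichSeq q j : ℚ) := by
      refine (hv.range_inj hw).1 (Set.Subset.antisymm ?_ ?_)
      · rintro _ ⟨j, rfl⟩
        obtain ⟨b, hb⟩ := hβ j j.2
        obtain ⟨i, hi, hbi⟩ := (exists_ulrichSeq_eq_iff (abs_nonneg b)).2
          ((hT |b| (abs_nonneg b)).1 ⟨j, j.2, by rw [hb]; simp⟩)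
        refine ⟨⟨i, hi⟩, ?_⟩
        simp only [absLast_eq_abs h1 h2 j.2, hb, ← hbi, Int.cast_abs]
      · rintro _ ⟨j, rfl⟩
        have hnn : 0 ≤ ulrichSeq q j := by have := j.2; unfold ulrichSeq; omega
        obtain ⟨i, hi, h⟩ := (hT _ hnn).2 ((exists_ulrichSeq_eq_iff hnn).1 ⟨j, j.2, rfl⟩)
        refine ⟨⟨i, hi⟩, ?_⟩
        simp only [absLast_eq_abs h1 h2 hi, ← h]
        exact abs_of_nonneg (by exact_mod_cast hnn)
    exact fun j hj => congrFun hrange ⟨j, hj⟩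
  · rintro ⟨q, rfl, h0, h1', h2', hb⟩
    have hT : ∀ s, AbsMem (2 * q) β s ↔ |s| < 6 * q ∧ (|s| % 6 = 4 ∨ |s| % 6 = 5) := by
      intro s
      rw [← exists_ulrichSeq_eq_iff (abs_nonneg s)]
      refine exists_congr fun j => and_congr_right fun hj => ?_
      rw [← absLast_eq_abs h1 h2 hj, hb j hj]
      norm_cast
    ext t
    rw [mem_SD_three_iff (a0 := 3 * (2 * q : ℕ) + 4) (a1 := 3 * (2 * q : ℕ) + 2)
      (a2 := 3 * (2 * q : ℕ)) (by rw [h0]; push_cast; rfl) (by rw [h1']; push_cast; rfl)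
      (by rw [h2']; push_cast; rfl), hT, hT, hT, Set.mem_Icc]
    push_cast
    simp only [abs_eq_max_neg]
    omega

/-- Classification of irreducible equivariant Ulrich bundles on `OGr(3, 2n)`:
a pair `(α, β)` with `S_D(α,β) = {1, …, 6n-15}` exists iff `n - 3` is even;
and for given `(α, β)`, `S_D(α,β) = {1, …, 6n-15}` holds iff `n - 3 = 2q`,
`α = (3n-5, 3n-7, 3n-9)`, and the sequence `(β₁, …, β_{l-1}, |β_l|)` satisfies
`β_{2m+1} = D - 2 - 6m`, `β_{2m+2} = D - 3 - 6m` for `0 ≤ m ≤ q-1`, where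
`D = 3n - 8`. -/
theorem stmt14 (n : ℕ) (hn : 4 ≤ n) :
    ((∃ α β : ℕ → ℚ, HypD3 n α β ∧
        SD 3 (n - 3) α β = Set.Icc (1 : ℤ) (6 * (n : ℤ) - 15)) ↔ Even (n - 3)) ∧
    (∀ α β : ℕ → ℚ, HypD3 n α β →
      (SD 3 (n - 3) α β = Set.Icc (1 : ℤ) (6 * (n : ℤ) - 15) ↔
        ∃ q : ℕ, n - 3 = 2 * q ∧
          α 0 = 3 * (n : ℚ) - 5 ∧ α 1 = 3 * (n : ℚ) - 7 ∧ α 2 = 3 * (n : ℚ) - 9 ∧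
          ∀ m < q,
            absLast (n - 3) β (2 * m) = (3 * (n : ℚ) - 8) - 2 - 6 * m ∧
            absLast (n - 3) β (2 * m + 1) = (3 * (n : ℚ) - 8) - 3 - 6 * m)) := by
  obtain ⟨l, rfl⟩ : ∃ l, n = l + 3 := ⟨n - 3, by omega⟩
  have hl : 0 < l := by omega
  have hd : (6 * ((l + 3 : ℕ) : ℤ) - 15) = 6 * l + 3 := by push_cast; ring
  simp only [HypD3, hd, Nat.add_sub_cancel, show l + 3 - 4 = l - 1 by omega,
    show l + 3 - 5 = l - 2 by omega]
  have main : ∀ α β : ℕ → ℚ, _ → _ := fun α β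
    (H : (∀ i j, i < j → j < 3 → α j < α i) ∧ (∀ i j, i < j → j + 1 < l → β j < β i) ∧
      (2 ≤ l → |β (l - 1)| < β (l - 2)) ∧
      (((∀ i < 3, ∃ m : ℤ, α i = m) ∧ ∀ j < l, ∃ m : ℤ, β j = m) ∨
      ((∀ i < 3, ∃ m : ℤ, α i = m + 1 / 2) ∧ ∀ j < l, ∃ m : ℤ, β j = m + 1 / 2))) =>
    SD_eq_Icc_iff hl H.1 H.2.1 H.2.2.1 H.2.2.2
  refine ⟨⟨?_, ?_⟩, ?_⟩
  · rintro ⟨α, β, H, h⟩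
    obtain ⟨q, hq, -⟩ := (main α β H).1 h
    exact ⟨q, by omega⟩
  · rintro ⟨q, hq⟩
    obtain rfl : l = 2 * q := by omega
    have hanti := ulrichSeq_strictAnti q
    have hlast : (0 : ℤ) ≤ ulrichSeq q (2 * q - 1) := by unfold ulrichSeq; omega
    have H : (∀ i j : ℕ, i < j → j < 3 →
        (3 * (2 * q : ℕ) + 4 - 2 * j : ℚ) < 3 * (2 * q : ℕ) + 4 - 2 * i) ∧
        (∀ i j, i < j → j + 1 < 2 * q → (ulrichSeq q j : ℚ) < ulrichSeq q i) ∧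
        (2 ≤ 2 * q → |(ulrichSeq q (2 * q - 1) : ℚ)| < ulrichSeq q (2 * q - 2)) := by
      refine ⟨fun i j hij _ => ?_, fun i j hij _ => by exact_mod_cast hanti hij, fun _ => ?_⟩
      · have : (i : ℚ) < j := by exact_mod_cast hij
        linarith
      · rw [abs_of_nonneg (by exact_mod_cast hlast)]
        exact_mod_cast hanti (by omega)
    refine ⟨fun i => 3 * (2 * q : ℕ) + 4 - 2 * i, fun j => ulrichSeq q j,
      ⟨H.1, H.2.1, H.2.2, Or.inl ⟨fun i _ => ⟨3 * (2 * q : ℕ) + 4 - 2 * i, by push_cast; ring⟩,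
        fun j _ => ⟨_, rfl⟩⟩⟩, (main _ _ ⟨H.1, H.2.1, H.2.2, Or.inl
          ⟨fun i _ => ⟨3 * (2 * q : ℕ) + 4 - 2 * i, by push_cast; ring⟩,
        fun j _ => ⟨_, rfl⟩⟩⟩).2 ⟨q, rfl, by push_cast; ring, by push_cast; ring,
          by push_cast; ring, ?_⟩⟩
    intro j hj
    rw [absLast_eq_abs H.2.1 H.2.2 hj]
    exact abs_of_nonneg (Int.cast_nonneg (by unfold ulrichSeq; omega))
  · intro α β H
    rw [main α β H]
    refine exists_congr fun q => and_congr_right fun hq => ?_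
    rw [forall_ulrichSeq_iff]
    subst hq
    push_cast
    ring_nf
end
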